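/- arXiv:1407.5374 — 2 statements merged into one kernel-verified Lean document; each statement's English description precedes it below -/
import Mathlib

section
/- Every finite simple graph G with maximum degree Δ and girth at least 7 admits an acyclic edge coloring using at most ⌈3.326(Δ-1)⌉ + 1 colors; that is, there is a proper edge coloring of G with ⌈3.326(Δ-1)⌉ + 1 colors under which every cycle of G receives at least three distinct colors on its edges. -/
/-- `col` is a proper edge coloring of `G`: distinct edges sharing an endpoint
receive distinct colors. -/
def IsProperEdgeColoring {V : Type*} (G : SimpleGraph V) (col : Sym2 V → ℕ) : Prop :=
  ∀ e₁ ∈ G.edgeSet, ∀ e₂ ∈ G.edgeSet, e₁ ≠ e₂ → (∃ v, v ∈ e₁ ∧ v ∈ e₂) →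
    col e₁ ≠ col e₂


set_option linter.unusedSectionVars false
namespace AEC
open Finset

variable {V : Type*} [Fintype V] [DecidableEq V]

/-- Two distinct edges sharing an endpoint. -/
def Adjc (e f : Sym2 V) : Prop := e ≠ f ∧ ∃ v, v ∈ e ∧ v ∈ f

lemma Adjc.symm {e f : Sym2 V} (h : Adjc e f) : Adjc f e :=
  ⟨h.1.symm, h.2.imp fun _ hv => ⟨hv.2, hv.1⟩⟩

open Classical in
/-- Number of edges of `H` adjacent to `e`. -/
noncomputable def nb (H : Finset (Sym2 V)) (e : Sym2 V) : ℕ := (H.filter (Adjc e)).card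

/-- `c` is a proper acyclic coloring of the edge set `H`. -/
def Good (G : SimpleGraph V) (H : Finset (Sym2 V)) (c : Sym2 V → ℕ) : Prop :=
  (∀ e ∈ H, ∀ f ∈ H, Adjc e f → c e ≠ c f) ∧
  ∀ (v : V) (w : G.Walk v v), w.IsCycle → (∀ e ∈ w.edges, e ∈ H) →
    3 ≤ (w.edges.map c).toFinset.card

open Classical in
/-- Acyclic list colorings of `H`. -/
noncomputable def cols (G : SimpleGraph V) (H : Finset (Sym2 V)) (L : Sym2 V → Finset ℕ) :
    Finset (Sym2 V → ℕ) :=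
  (Fintype.piFinset (fun e => if e ∈ H then L e else {0})).filter (Good G H)

open Classical in
/-- Lists after giving color `b` to edge `g`. -/
noncomputable def frz (L : Sym2 V → Finset ℕ) (g : Sym2 V) (b : ℕ) : Sym2 V → Finset ℕ :=
  fun f => if Adjc g f then (L f).erase b else L f

/-- Admissible lists. -/
def Adm (K κ : ℕ) (H : Finset (Sym2 V)) (L : Sym2 V → Finset ℕ) : Prop :=
  ∀ e ∈ H, L e ⊆ range K ∧ κ + nb H e ≤ (L e).card

/-- Alternating trail of length `n` from `v` to `t` in `H`, colors `b, a, b, ...`. -/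
def TR (c : Sym2 V → ℕ) (t : V) : ℕ → Finset (Sym2 V) → V → ℕ → ℕ → Prop
  | 0, _, v, _, _ => v = t
  | n + 1, H, v, b, a => ∃ w, s(v, w) ∈ H ∧ c s(v, w) = b ∧ TR c t n (H.erase s(v, w)) w a b

lemma mem_cols {G : SimpleGraph V} {H : Finset (Sym2 V)} {L : Sym2 V → Finset ℕ}
    {c : Sym2 V → ℕ} : c ∈ cols G H L ↔
      (∀ e ∈ H, c e ∈ L e) ∧ (∀ e, e ∉ H → c e = 0) ∧ Good G H c := by
  classical
  simp only [cols, mem_filter, Fintype.mem_piFinset]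
  constructor
  · rintro ⟨h, hg⟩
    refine ⟨fun e he => by simpa [he] using h e, fun e he => by simpa [he] using h e, hg⟩
  · rintro ⟨h1, h2, hg⟩
    refine ⟨fun e => ?_, hg⟩
    by_cases he : e ∈ H
    · simpa [he] using h1 e he
    · simpa [he] using h2 e he

lemma Adm.erase {K κ : ℕ} {H : Finset (Sym2 V)} {L : Sym2 V → Finset ℕ}
    (h : Adm K κ H L) (g : Sym2 V) : Adm K κ (H.erase g) L := by
  intro e he
  obtain ⟨h1, h2⟩ := h e (mem_of_mem_erase he)
  refine ⟨h1, le_trans ?_ h2⟩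
  unfold nb
  gcongr
  exact erase_subset _ _

lemma Adm.frz {K κ : ℕ} {H : Finset (Sym2 V)} {L : Sym2 V → Finset ℕ}
    (h : Adm K κ H L) {g : Sym2 V} (hg : g ∈ H) (b : ℕ) : Adm K κ (H.erase g) (frz L g b) := by
  classical
  intro e he
  obtain ⟨h1, h2⟩ := h e (mem_of_mem_erase he)
  unfold AEC.frz
  by_cases ha : Adjc g e
  · simp only [ha, if_true]
    refine ⟨(erase_subset _ _).trans h1, ?_⟩
    have h3 : nb H e = nb (H.erase g) e + 1 := by
      unfold nb
      rw [filter_erase, card_erase_add_one]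
      exact mem_filter.2 ⟨hg, ha.symm⟩
    have h4 := pred_card_le_card_erase (s := L e) (a := b)
    omega
  · simp only [ha, if_false]
    exact (h.erase g) e he |>.imp id id

lemma TR_congr {c c' : Sym2 V → ℕ} {t : V} (n : ℕ) : ∀ {H : Finset (Sym2 V)} {v : V} {b a : ℕ},
    (∀ e ∈ H, c e = c' e) → TR c t n H v b a → TR c' t n H v b a := by
  induction n with
  | zero => intro H v b a _ h; exact h
  | succ n ih =>
    rintro H v b a hc ⟨w, hw, hb, h⟩
    exact ⟨w, hw, (hc _ hw) ▸ hb, ih (fun e he => hc e (mem_of_mem_erase he)) h⟩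

lemma TR_le {c : Sym2 V → ℕ} {t : V} (n : ℕ) : ∀ {H : Finset (Sym2 V)} {v : V} {b a : ℕ},
    TR c t n H v b a → n ≤ H.card := by
  induction n with
  | zero => intro H v b a _; omega
  | succ n ih =>
    rintro H v b a ⟨w, hw, hb, h⟩
    have := ih h
    rw [card_erase_of_mem hw] at this
    have := card_pos.2 ⟨_, hw⟩
    omega

lemma TR_last {c : Sym2 V → ℕ} {t : V} (n : ℕ) : ∀ {H : Finset (Sym2 V)} {v : V} {b a : ℕ},
    TR c t (n+1) H v b a → ∃ f ∈ H, t ∈ f ∧ c f = if Even n then b else a := by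
  induction n with
  | zero =>
    rintro H v b a ⟨w, hw, hb, h⟩
    have h' : w = t := h
    subst h'
    exact ⟨_, hw, by simp, by simpa using hb⟩
  | succ n ih =>
    rintro H v b a ⟨w, hw, hb, h⟩
    obtain ⟨f, hf, ht, hc⟩ := ih h
    refine ⟨f, mem_of_mem_erase hf, ht, ?_⟩
    rw [hc]
    by_cases he : Even n <;> simp [he, Nat.even_add_one]

/-- A 2-colored trail yields `TR`. -/
lemma TR_of_walk {G : SimpleGraph V} {c : Sym2 V → ℕ} {t v : V} (p : G.Walk v t) :
    ∀ {H : Finset (Sym2 V)} {b a : ℕ}, p.edges.Nodup → (∀ e ∈ p.edges, e ∈ H) →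
    (∀ e ∈ H, ∀ f ∈ H, Adjc e f → c e ≠ c f) →
    (∀ e ∈ p.edges, c e = a ∨ c e = b) → (∀ f ∈ H, v ∈ f → c f ≠ a) →
    TR c t p.length H v b a := by
  induction p with
  | nil => intros; rfl
  | @cons v w t h p ih =>
    intro H b a hn hH hp hc hna
    rw [SimpleGraph.Walk.edges_cons] at hn hH hc
    rw [List.nodup_cons] at hn
    have hg : s(v, w) ∈ H := hH _ (by simp)
    have hb : c s(v, w) = b := (hc _ (by simp)).resolve_left (hna _ hg (by simp))
    rw [SimpleGraph.Walk.length_cons]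
    refine ⟨w, hg, hb, ih hn.2 ?_ ?_ ?_ ?_⟩
    · intro e he
      exact mem_erase.2 ⟨fun h' => hn.1 (h' ▸ he), hH e (by simp [he])⟩
    · intro e he f hf
      exact hp e (mem_of_mem_erase he) f (mem_of_mem_erase hf)
    · intro e he
      exact (hc e (by simp [he])).symm
    · intro f hf hw hfb
      refine hp f (mem_of_mem_erase hf) _ hg ⟨ne_of_mem_erase hf, w, hw, by simp⟩ ?_
      rw [hfb, hb]

lemma split_dart {G : SimpleGraph V} {a b : V} (w : G.Walk a b) :
    ∀ {u v : V} (h : G.Adj u v), (⟨(u, v), h⟩ : G.Dart) ∈ w.darts →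
    ∃ (p1 : G.Walk a u) (p2 : G.Walk v b), w.edges = p1.edges ++ s(u, v) :: p2.edges := by
  induction w with
  | nil => intro u v h hd; simp at hd
  | @cons a x b hax p ih =>
    intro u v h hd
    rw [SimpleGraph.Walk.darts_cons, List.mem_cons] at hd
    rcases hd with hd | hd
    · have h1 : u = a := congrArg (fun d : G.Dart => d.fst) hd
      have h2 : v = x := congrArg (fun d : G.Dart => d.snd) hd
      subst h1; subst h2
      exact ⟨.nil, p, by simp⟩
    · obtain ⟨p1, p2, he⟩ := ih h hd
      exact ⟨.cons hax p1, p2, by simp [he]⟩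

lemma split_cycle {G : SimpleGraph V} {a : V} (w : G.Walk a a) {u v : V}
    (hg : s(u, v) ∈ w.edges) :
    ∃ p : G.Walk v u, w.edges.Perm (s(u, v) :: p.edges) := by
  obtain ⟨⟨⟨x, y⟩, hxy⟩, hd, he⟩ := List.mem_map.1 hg
  have he' : s(x, y) = s(u, v) := he
  rw [Sym2.eq_iff] at he'
  rcases he' with ⟨rfl, rfl⟩ | ⟨rfl, rfl⟩
  · obtain ⟨p1, p2, h⟩ := split_dart w hxy hd
    refine ⟨p2.append p1, ?_⟩
    rw [h, SimpleGraph.Walk.edges_append]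
    exact List.perm_append_comm
  · obtain ⟨p1, p2, h⟩ := split_dart w hxy hd
    refine ⟨(p2.append p1).reverse, ?_⟩
    rw [h, SimpleGraph.Walk.edges_reverse, SimpleGraph.Walk.edges_append, Sym2.eq_swap]
    exact List.perm_append_comm.trans (List.Perm.cons _ (List.reverse_perm _).symm)

/-- key: a bad extension yields an alternating trail. -/
lemma ext_good {G : SimpleGraph V}
    (hgirth : ∀ (v : V) (w : G.Walk v v), w.IsCycle → 7 ≤ w.length)
    {H : Finset (Sym2 V)} {c : Sym2 V → ℕ} {u v : V} {x : ℕ} (hg : s(u, v) ∉ H)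
    (hc : Good G H c) (hx : ∀ f ∈ H, Adjc s(u, v) f → c f ≠ x)
    (hno : ∀ y, (∃ f ∈ H, c f = y) → ∀ n ∈ Ico 7 (H.card + 1), ¬ TR c u n H v y x) :
    Good G (insert s(u, v) H) (Function.update c s(u, v) x) := by
  have hup : ∀ f ∈ H, Function.update c s(u, v) x f = c f := by
    intro f hf
    rw [Function.update_of_ne]
    rintro rfl; exact hg hf
  constructor
  · intro e he f hf hef
    rw [mem_insert] at he hf
    rcases he with rfl | he <;> rcases hf with rfl | hf
    · exact absurd rfl hef.1
    · rw [Function.update_self, hup f hf]; exact (hx f hf hef).symm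
    · rw [Function.update_self, hup e he]; exact hx e he hef.symm
    · rw [hup e he, hup f hf]; exact hc.1 e he f hf hef
  · intro a w hw hwH
    by_cases hgw : s(u, v) ∈ w.edges
    · by_contra hlt
      obtain ⟨p, hp⟩ := split_cycle w hgw
      have hnd : (s(u, v) :: p.edges).Nodup := hp.nodup_iff.1 hw.isTrail.edges_nodup
      rw [List.nodup_cons] at hnd
      have hpH : ∀ e ∈ p.edges, e ∈ H := by
        intro e he
        have := hwH e (hp.mem_iff.2 (by simp [he]))
        rw [mem_insert] at this
        rcases this with rfl | h
        · exact absurd he hnd.1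
        · exact h
      have hlen : w.length = p.length + 1 := by
        have := hp.length_eq
        simpa using this
      have h7 := hgirth a w hw
      have hcolset : ∀ e ∈ p.edges, c e ∈ (w.edges.map (Function.update c s(u, v) x)).toFinset := by
        intro e he
        rw [List.mem_toFinset, List.mem_map]
        exact ⟨e, hp.mem_iff.2 (by simp [he]), hup e (hpH e he)⟩
      have hxset : x ∈ (w.edges.map (Function.update c s(u, v) x)).toFinset := by
        rw [List.mem_toFinset, List.mem_map]
        exact ⟨_, hgw, by simp⟩
      -- every edge at `v` or `u` in `H` avoids `x`
      have hvx : ∀ f ∈ H, v ∈ f → c f ≠ x := by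
        intro f hf hvf
        exact hx f hf ⟨fun h => hg (h ▸ hf), v, by simp, hvf⟩
      have hux : ∀ f ∈ H, u ∈ f → c f ≠ x := by
        intro f hf hvf
        exact hx f hf ⟨fun h => hg (h ▸ hf), u, by simp, hvf⟩
      obtain ⟨e1, he1, hve1⟩ : ∃ e ∈ p.edges, v ∈ e := by
        cases p with
        | nil => simp at hlen; omega
        | @cons _ y _ h q => exact ⟨s(v, y), by simp, by simp⟩
      have hyx : c e1 ≠ x := hvx e1 (hpH e1 he1) hve1
      have hall : ∀ e ∈ p.edges, c e = x ∨ c e = c e1 := by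
        intro e he
        by_contra hcon
        push Not at hcon
        apply hlt
        have : ({x, c e1, c e} : Finset ℕ) ⊆
            (w.edges.map (Function.update c s(u, v) x)).toFinset := by
          intro z hz
          simp only [mem_insert, mem_singleton] at hz
          rcases hz with rfl | rfl | rfl
          · exact hxset
          · exact hcolset _ he1
          · exact hcolset _ he
        refine le_trans (le_of_eq ?_) (card_le_card this)
        rw [card_eq_three.2 ⟨x, c e1, c e, hyx.symm, hcon.1.symm, hcon.2.symm, rfl⟩]
      have hTR := TR_of_walk p hnd.2 hpH hc.1 hall hvx
      have hle := TR_le _ hTR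
      by_cases h6 : p.length = 6
      · rw [h6] at hTR
        obtain ⟨f, hf, huf, hcf⟩ := TR_last 5 hTR
        refine hux f hf huf ?_
        rw [hcf, if_neg (by decide)]
      · exact hno (c e1) ⟨e1, hpH e1 he1, rfl⟩ p.length (by rw [mem_Ico]; omega) hTR
    · have hwH' : ∀ e ∈ w.edges, e ∈ H := by
        intro e he
        rcases mem_insert.1 (hwH e he) with rfl | h
        · exact absurd he hgw
        · exact h
      have := hc.2 a w hw hwH'
      rwa [List.map_congr_left (fun e he => hup e (hwH' e he))]

lemma Good.erase {G : SimpleGraph V} {H : Finset (Sym2 V)} {c : Sym2 V → ℕ} (h : Good G H c)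
    (g : Sym2 V) (z : ℕ) : Good G (H.erase g) (Function.update c g z) := by
  have hup : ∀ f ∈ H.erase g, Function.update c g z f = c f := by
    intro f hf
    rw [Function.update_of_ne (ne_of_mem_erase hf)]
  constructor
  · intro e he f hf hef
    rw [hup e he, hup f hf]
    exact h.1 e (mem_of_mem_erase he) f (mem_of_mem_erase hf) hef
  · intro a w hw hwH
    have := h.2 a w hw (fun e he => mem_of_mem_erase (hwH e he))
    rwa [List.map_congr_left (fun e he => hup e (hwH e he))]

end AEC
set_option linter.unusedSectionVars false
namespace AEC
open Finset
variable {V : Type*} [Fintype V] [DecidableEq V]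

open Classical in
/-- Colorings for which giving color `x` to `s(u,v)` may close a bichromatic cycle. -/
noncomputable def bads (G : SimpleGraph V) (K : ℕ) (H : Finset (Sym2 V)) (L : Sym2 V → Finset ℕ)
    (u v : V) (x : ℕ) : Finset (Sym2 V → ℕ) :=
  (cols G H L).filter (fun c => ∃ y ∈ range K, ∃ n ∈ Ico 7 (H.card + 1), TR c u n H v y x)

open Classical in
lemma ext_count {G : SimpleGraph V}
    (hgirth : ∀ (v : V) (w : G.Walk v v), w.IsCycle → 7 ≤ w.length) {K : ℕ}
    {H : Finset (Sym2 V)} {L L' : Sym2 V → Finset ℕ} {u v : V} (hg : s(u, v) ∈ H)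
    {X : Finset ℕ} (hL' : ∀ f ∈ H.erase s(u, v), L' f ⊆ L f)
    (hLK : ∀ f ∈ H.erase s(u, v), L' f ⊆ range K) (hX : X ⊆ L s(u, v)) (k : ℕ)
    (hk : ∀ c ∈ cols G (H.erase s(u, v)) L',
      k ≤ (X.filter (fun x => ∀ f ∈ H.erase s(u, v), Adjc s(u, v) f → c f ≠ x)).card) :
    k * (cols G (H.erase s(u, v)) L').card ≤
      ((cols G H L).filter (fun c => c s(u, v) ∈ X ∧
        Function.update c s(u, v) 0 ∈ cols G (H.erase s(u, v)) L')).card +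
      ∑ x ∈ X, (bads G K (H.erase s(u, v)) L' u v x).card := by
  set g := s(u, v) with hgdef
  set H' := H.erase g with hH'
  have hgH' : g ∉ H' := notMem_erase _ _
  set P : Finset (Σ _ : (Sym2 V → ℕ), ℕ) := (cols G H' L').sigma
    (fun c => X.filter (fun x => ∀ f ∈ H', Adjc g f → c f ≠ x)) with hP
  have h1 : k * (cols G H' L').card ≤ P.card := by
    rw [hP, card_sigma, mul_comm, ← smul_eq_mul]
    exact card_nsmul_le_sum _ _ _ hk
  refine h1.trans ?_
  rw [← card_filter_add_card_filter_not (s := P) (fun p => p.1 ∈ bads G K H' L' u v p.2), add_comm]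
  refine add_le_add ?_ ?_
  · refine card_le_card_of_injOn (fun p => Function.update p.1 g p.2) ?_ ?_
    · rintro ⟨c, x⟩ hp
      simp only [coe_filter, Set.mem_ofPred_eq, hP, mem_sigma, mem_filter] at hp
      obtain ⟨⟨hc, hx, hpr⟩, hnb⟩ := hp
      have hc' := mem_cols.1 hc
      have hgood : Good G (insert g H') (Function.update c g x) := by
        refine ext_good hgirth hgH' hc'.2.2 hpr ?_
        rintro y ⟨f, hf, rfl⟩ n hn hT
        apply hnb
        simp only [bads, mem_filter]
        exact ⟨hc, c f, hLK f hf (hc'.1 f hf), n, hn, hT⟩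
      rw [hH', insert_erase hg] at hgood
      simp only [coe_filter, Set.mem_ofPred_eq, Function.update_self, Function.update_idem]
      refine ⟨mem_cols.2 ⟨?_, ?_, hgood⟩, hx, ?_⟩
      · intro e he
        by_cases h : e = g
        · subst h; rw [Function.update_self]; exact hX hx
        · rw [Function.update_of_ne h]
          have : e ∈ H' := mem_erase.2 ⟨h, he⟩
          exact hL' e this (hc'.1 e this)
      · intro e he
        have h : e ≠ g := by rintro rfl; exact he hg
        rw [Function.update_of_ne h]
        exact hc'.2.1 e (fun h => he (mem_of_mem_erase h))
      · have : Function.update c g 0 = c := by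
          rw [← hc'.2.1 g hgH', Function.update_eq_self]
        rw [this]; exact hc
    · rintro ⟨c, x⟩ hp ⟨c', x'⟩ hp' heq
      simp only [coe_filter, Set.mem_ofPred_eq, hP, mem_sigma, mem_filter] at hp hp'
      have hc := mem_cols.1 hp.1.1
      have hc' := mem_cols.1 hp'.1.1
      simp only at heq
      have e1 : x = x' := by
        have := congrFun heq g
        simpa using this
      have e2 : c = c' := by
        funext f
        by_cases h : f = g
        · subst h; rw [hc.2.1 _ hgH', hc'.2.1 _ hgH']
        · have := congrFun heq f
          rwa [Function.update_of_ne h, Function.update_of_ne h] at this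
      subst e1; subst e2; rfl
  · rw [← card_sigma]
    refine card_le_card_of_injOn (fun p => ⟨p.2, p.1⟩) ?_ ?_
    · rintro ⟨c, x⟩ hp
      simp only [coe_filter, Set.mem_ofPred_eq, hP, mem_sigma, mem_filter] at hp
      simp only [coe_sigma, Set.mem_sigma_iff, mem_coe]
      exact ⟨hp.1.2.1, hp.2⟩
    · rintro ⟨c, x⟩ hp ⟨c', x'⟩ hp' heq
      simp only [Sigma.mk.injEq, heq_eq_eq] at heq
      rw [heq.1, heq.2]

/-- update-by-zero map into frozen colorings -/
lemma upd_mem {G : SimpleGraph V} {H : Finset (Sym2 V)} {L : Sym2 V → Finset ℕ} {c : Sym2 V → ℕ}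
    {g : Sym2 V} {b : ℕ} (hg : g ∈ H) (hc : c ∈ cols G H L) (hb : c g = b) :
    Function.update c g 0 ∈ cols G (H.erase g) (frz L g b) := by
  classical
  obtain ⟨h1, h2, h3⟩ := mem_cols.1 hc
  refine mem_cols.2 ⟨?_, ?_, h3.erase g 0⟩
  · intro e he
    have hne := ne_of_mem_erase he
    have heH := mem_of_mem_erase he
    rw [Function.update_of_ne hne]
    unfold frz
    split_ifs with ha
    · refine mem_erase.2 ⟨?_, h1 e heH⟩
      rw [← hb]; exact h3.1 e heH g hg ha.symm
    · exact h1 e heH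
  · intro e he
    by_cases h : e = g
    · subst h; simp
    · rw [Function.update_of_ne h]
      exact h2 e (fun h' => he (mem_erase.2 ⟨h, h'⟩))

lemma upd_inj {c c' : Sym2 V → ℕ} {g : Sym2 V} (h : c g = c' g)
    (heq : Function.update c g 0 = Function.update c' g 0) : c = c' := by
  funext f
  by_cases hf : f = g
  · rw [hf, h]
  · have := congrFun heq f
    rwa [Function.update_of_ne hf, Function.update_of_ne hf] at this

/-- count of colorings in which a trail exists -/
noncomputable def tcnt (G : SimpleGraph V) (H : Finset (Sym2 V)) (L : Sym2 V → Finset ℕ)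
    (t : V) (n : ℕ) (v : V) (b a : ℕ) : ℝ := by
  classical exact (((cols G H L).filter (fun c => TR c t n H v b a)).card : ℝ)

noncomputable def cnt (G : SimpleGraph V) (H : Finset (Sym2 V)) (L : Sym2 V → Finset ℕ) : ℝ :=
  ((cols G H L).card : ℝ)

/-- frozen count -/
noncomputable def F (G : SimpleGraph V) (H : Finset (Sym2 V)) (L : Sym2 V → Finset ℕ)
    (g : Sym2 V) (b : ℕ) : ℝ := cnt G (H.erase g) (frz L g b)

/-- colored count -/
noncomputable def ecnt (G : SimpleGraph V) (H : Finset (Sym2 V)) (L : Sym2 V → Finset ℕ)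
    (g : Sym2 V) (b : ℕ) : ℝ := (((cols G H L).filter (fun c => c g = b)).card : ℝ)

/-- next vertices -/
def nxt (H : Finset (Sym2 V)) (v : V) : Finset V := univ.filter (fun w => s(v, w) ∈ H)

lemma mem_nxt {H : Finset (Sym2 V)} {v w : V} : w ∈ nxt H v ↔ s(v, w) ∈ H := by simp [nxt]

lemma card_nxt_le (H : Finset (Sym2 V)) (v : V) :
    (nxt H v).card ≤ (H.filter (fun e => v ∈ e)).card := by
  refine card_le_card_of_injOn (fun w => s(v, w)) ?_ ?_
  · intro w hw
    have := mem_nxt.1 hw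
    simp [this]
  · intro w _ w' _ h
    have h' : w = w' ∨ v = w' ∧ w = v := by simpa using h
    rcases h' with h' | ⟨h1, h2⟩
    · exact h'
    · exact h2.trans h1

lemma F_nonneg {G : SimpleGraph V} {H : Finset (Sym2 V)} {L : Sym2 V → Finset ℕ} {g : Sym2 V}
    {b : ℕ} : 0 ≤ F G H L g b := by unfold F cnt; positivity
lemma cnt_nonneg {G : SimpleGraph V} {H : Finset (Sym2 V)} {L : Sym2 V → Finset ℕ} :
    0 ≤ cnt G H L := by unfold cnt; positivity
lemma tcnt_nonneg {G : SimpleGraph V} {H : Finset (Sym2 V)} {L : Sym2 V → Finset ℕ}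
    {t v : V} {n b a : ℕ} : 0 ≤ tcnt G H L t n v b a := by unfold tcnt; positivity

lemma tcnt_le_cnt {G : SimpleGraph V} {H : Finset (Sym2 V)} {L : Sym2 V → Finset ℕ}
    {t v : V} {n b a : ℕ} : tcnt G H L t n v b a ≤ cnt G H L := by
  classical
  unfold tcnt cnt
  exact_mod_cast card_filter_le _ _

lemma ecnt_le_F {G : SimpleGraph V} {H : Finset (Sym2 V)} {L : Sym2 V → Finset ℕ} {g : Sym2 V}
    {b : ℕ} (hg : g ∈ H) : ecnt G H L g b ≤ F G H L g b := by
  unfold ecnt F cnt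
  norm_cast
  refine card_le_card_of_injOn (fun c => Function.update c g 0) ?_ ?_
  · intro c hc
    rw [mem_coe, mem_filter] at hc
    exact upd_mem hg hc.1 hc.2
  · intro c hc c' hc' heq
    rw [mem_coe, mem_filter] at hc hc'
    exact upd_inj (hc.2.trans hc'.2.symm) heq

lemma tcnt_succ {G : SimpleGraph V} {H : Finset (Sym2 V)} {L : Sym2 V → Finset ℕ}
    {t v : V} {n b a : ℕ} : tcnt G H L t (n+1) v b a ≤
      ∑ w ∈ (nxt H v).filter (fun w => b ∈ L s(v, w)),
        tcnt G (H.erase s(v, w)) (frz L s(v, w) b) t n w a b := by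
  classical
  unfold tcnt
  norm_cast
  have h1 : (cols G H L).filter (fun c => TR c t (n+1) H v b a) ⊆
      ((nxt H v).filter (fun w => b ∈ L s(v, w))).biUnion (fun w =>
        (cols G H L).filter
          (fun c => c s(v, w) = b ∧ TR c t n (H.erase s(v, w)) w a b)) := by
    intro c hc
    rw [mem_filter] at hc
    obtain ⟨hc, w, hw, hb, hT⟩ := hc
    rw [mem_biUnion]
    refine ⟨w, mem_filter.2 ⟨mem_nxt.2 hw, ?_⟩, mem_filter.2 ⟨hc, hb, hT⟩⟩
    rw [← hb]; exact (mem_cols.1 hc).1 _ hw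
  refine (card_le_card h1).trans (card_biUnion_le.trans (sum_le_sum ?_))
  intro w hw
  rw [mem_filter, mem_nxt] at hw
  refine card_le_card_of_injOn (fun c => Function.update c s(v, w) 0) ?_ ?_
  · intro c hc
    rw [mem_coe, mem_filter] at hc
    rw [mem_coe, mem_filter]
    refine ⟨upd_mem hw.1 hc.1 hc.2.1, TR_congr n ?_ hc.2.2⟩
    intro e he
    show c e = Function.update c s(v, w) 0 e
    rw [Function.update_of_ne (ne_of_mem_erase he)]
  · intro c hc c' hc' heq
    rw [mem_coe, mem_filter] at hc hc'
    exact upd_inj (hc.2.1.trans hc'.2.1.symm) heq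

lemma tcnt_one_le {G : SimpleGraph V} {H : Finset (Sym2 V)} {L : Sym2 V → Finset ℕ}
    {t v : V} {b a : ℕ} : tcnt G H L t 1 v b a ≤ ecnt G H L s(v, t) b ∧
      (s(v, t) ∉ H → tcnt G H L t 1 v b a = 0) := by
  classical
  unfold tcnt ecnt
  constructor
  · norm_cast
    refine card_le_card ?_
    intro c hc
    rw [mem_filter] at hc ⊢
    obtain ⟨hc, w, hw, hb, hT⟩ := hc
    refine ⟨hc, ?_⟩
    have hT' : w = t := hT
    subst hT'; exact hb
  · intro h
    rw [Nat.cast_eq_zero, card_eq_zero, filter_eq_empty_iff]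
    rintro c _ ⟨w, hw, hb, hT⟩
    have hT' : w = t := hT
    subst hT'; exact h hw

end AEC
set_option linter.unusedSectionVars false
namespace AEC
open Finset
variable {V : Type*} [Fintype V] [DecidableEq V]

/-- The bound on bad events. -/
def BadBd (G : SimpleGraph V) (K κ d : ℕ) (E H : Finset (Sym2 V)) : Prop :=
  ∀ L, Adm K κ H L → ∀ u v, s(u, v) ∈ E → s(u, v) ∉ H →
    (∑ x ∈ range K, ((bads G K H L u v x).card : ℝ) ≤ 0.076 * d * cnt G H L) ∧
    ∀ x, ((bads G K H L u v x).card : ℝ) ≤ 0.05 * cnt G H L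

open Classical in
lemma avail {H : Finset (Sym2 V)} {g : Sym2 V} (c : Sym2 V → ℕ) (X : Finset ℕ) :
    X.card ≤ (X.filter (fun x => ∀ f ∈ H.erase g, Adjc g f → c f ≠ x)).card + nb H g := by
  have h : X ⊆ (X.filter (fun x => ∀ f ∈ H.erase g, Adjc g f → c f ≠ x)) ∪
      (H.filter (Adjc g)).image c := by
    intro x hx
    rw [mem_union, mem_filter, mem_image]
    by_cases hh : ∀ f ∈ H.erase g, Adjc g f → c f ≠ x
    · exact Or.inl ⟨hx, hh⟩
    · push Not at hh
      obtain ⟨f, hf, ha, hc⟩ := hh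
      exact Or.inr ⟨f, mem_filter.2 ⟨mem_of_mem_erase hf, ha⟩, hc⟩
  refine (card_le_card h).trans ((card_union_le _ _).trans ?_)
  gcongr
  exact card_image_le

variable {G : SimpleGraph V} {K κ d : ℕ} {E : Finset (Sym2 V)}

lemma frz_sub {L : Sym2 V → Finset ℕ} {g f : Sym2 V} {b : ℕ} : frz L g b f ⊆ L f := by
  unfold frz
  split_ifs
  · exact erase_subset _ _
  · exact subset_rfl

open Classical in
lemma A1 (hgirth : ∀ (v : V) (w : G.Walk v v), w.IsCycle → 7 ≤ w.length)
    (hκ : 1.326 * (d : ℝ) + 1 ≤ κ) {H : Finset (Sym2 V)} (hHE : H ⊆ E) {L : Sym2 V → Finset ℕ}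
    (hA : Adm K κ H L) {u v : V} (hg : s(u, v) ∈ H) (hB : BadBd G K κ d E (H.erase s(u, v)))
    {b : ℕ} (hb : b ∈ L s(u, v)) :
    1.25 * d * F G H L s(u, v) b ≤ (((cols G H L).filter (fun c => c s(u, v) ≠ b ∧
      ∀ f ∈ H, Adjc s(u, v) f → c f ≠ b)).card : ℝ) := by
  have hAf := hA.frz hg b
  have hk1 : 1 ≤ κ := by
    have : (1 : ℝ) ≤ κ := by
      have : (0 : ℝ) ≤ d := by positivity
      linarith
    exact_mod_cast this
  have h := ext_count (K := K) hgirth hg (L := L) (L' := frz L s(u, v) b) (X := (L s(u, v)).erase b)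
    (fun f _ => frz_sub) (fun f hf => (hAf f hf).1) (erase_subset _ _) (κ - 1) (by
      intro c _
      have h1 := avail (H := H) (g := s(u, v)) c ((L s(u, v)).erase b)
      have h2 := (hA _ hg).2
      rw [card_erase_of_mem hb] at h1
      omega)
  have h3 := (hB _ hAf u v (hHE hg) (notMem_erase _ _)).1
  have h4 : (∑ x ∈ (L s(u, v)).erase b,
      ((bads G K (H.erase s(u, v)) (frz L s(u, v) b) u v x).card : ℝ)) ≤
      ∑ x ∈ range K, ((bads G K (H.erase s(u, v)) (frz L s(u, v) b) u v x).card : ℝ) :=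
    sum_le_sum_of_subset_of_nonneg ((erase_subset _ _).trans (hA _ hg).1)
      (fun _ _ _ => by positivity)
  have h5 : ((cols G H L).filter (fun c => c s(u, v) ∈ (L s(u, v)).erase b ∧
        Function.update c s(u, v) 0 ∈ cols G (H.erase s(u, v)) (frz L s(u, v) b))).card ≤
      ((cols G H L).filter (fun c => c s(u, v) ≠ b ∧
      ∀ f ∈ H, Adjc s(u, v) f → c f ≠ b)).card := by
    refine card_le_card ?_
    intro c hc
    rw [mem_filter] at hc ⊢
    obtain ⟨hc, hb', hu⟩ := hc
    refine ⟨hc, ne_of_mem_erase hb', ?_⟩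
    intro f hf ha
    have := (mem_cols.1 hu).1 f (mem_erase.2 ⟨ha.1.symm, hf⟩)
    rw [Function.update_of_ne ha.1.symm] at this
    unfold frz at this
    rw [if_pos ha] at this
    exact ne_of_mem_erase this
  have h6 : ((κ - 1 : ℕ) : ℝ) * F G H L s(u, v) b ≤
    (((cols G H L).filter (fun c => c s(u, v) ≠ b ∧
      ∀ f ∈ H, Adjc s(u, v) f → c f ≠ b)).card : ℝ) + ∑ x ∈ (L s(u, v)).erase b,
      ((bads G K (H.erase s(u, v)) (frz L s(u, v) b) u v x).card : ℝ) := by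
    unfold F cnt
    exact_mod_cast h.trans (Nat.add_le_add_right h5 _)
  rw [Nat.cast_sub hk1] at h6
  have h7 : (0 : ℝ) ≤ F G H L s(u, v) b := F_nonneg
  have h8 : cnt G (H.erase s(u, v)) (frz L s(u, v) b) = F G H L s(u, v) b := rfl
  rw [h8] at h3
  push_cast at h6
  nlinarith [mul_le_mul_of_nonneg_right hκ h7]

lemma A2 (hgirth : ∀ (v : V) (w : G.Walk v v), w.IsCycle → 7 ≤ w.length)
    {H : Finset (Sym2 V)} (hHE : H ⊆ E) {L : Sym2 V → Finset ℕ}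
    (hA : Adm K κ H L) {u v : V} (hg : s(u, v) ∈ H) (hB : BadBd G K κ d E (H.erase s(u, v)))
    {b : ℕ} (hb : b ∈ L s(u, v)) :
    0.95 * F G H L s(u, v) b ≤ ecnt G H L s(u, v) b := by
  classical
  have hAf := hA.frz hg b
  have h := ext_count (K := K) hgirth hg (L := L) (L' := frz L s(u, v) b) (X := {b})
    (fun f _ => frz_sub) (fun f hf => (hAf f hf).1) (singleton_subset_iff.2 hb) 1 (by
      intro c hc
      rw [Nat.one_le_iff_ne_zero, ← pos_iff_ne_zero, card_pos]
      refine ⟨b, mem_filter.2 ⟨mem_singleton_self _, ?_⟩⟩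
      intro f hf ha
      have := (mem_cols.1 hc).1 f hf
      unfold frz at this
      rw [if_pos ha] at this
      exact ne_of_mem_erase this)
  have h3 := (hB _ hAf u v (hHE hg) (notMem_erase _ _)).2 b
  rw [sum_singleton] at h
  have h5 : ((cols G H L).filter (fun c => c s(u, v) ∈ ({b} : Finset ℕ) ∧
        Function.update c s(u, v) 0 ∈ cols G (H.erase s(u, v)) (frz L s(u, v) b))).card ≤
      ((cols G H L).filter (fun c => c s(u, v) = b)).card := by
    refine card_le_card ?_
    intro c hc
    rw [mem_filter] at hc ⊢
    exact ⟨hc.1, mem_singleton.1 hc.2.1⟩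
  have h6 : F G H L s(u, v) b ≤ ecnt G H L s(u, v) b +
      ((bads G K (H.erase s(u, v)) (frz L s(u, v) b) u v b).card : ℝ) := by
    unfold F cnt ecnt
    have := h.trans (Nat.add_le_add_right h5 _)
    rw [one_mul] at this
    exact_mod_cast this
  have h8 : cnt G (H.erase s(u, v)) (frz L s(u, v) b) = F G H L s(u, v) b := rfl
  rw [h8] at h3
  linarith

lemma sum_ecnt {H : Finset (Sym2 V)} {L : Sym2 V → Finset ℕ} {g : Sym2 V} (S : Finset ℕ) :
    ∑ b ∈ S, ecnt G H L g b ≤ cnt G H L := by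
  unfold ecnt cnt
  norm_cast
  rw [← card_biUnion]
  · refine card_le_card ?_
    intro c hc
    rw [mem_biUnion] at hc
    obtain ⟨b, _, hc⟩ := hc
    exact (mem_filter.1 hc).1
  · intro b _ b' _ hbb
    rw [Function.onFun, disjoint_left]
    intro c hc hc'
    rw [mem_filter] at hc hc'
    exact hbb (hc.2.symm.trans hc'.2)

/-- sum over first edge and its color -/
lemma sumF (hgirth : ∀ (v : V) (w : G.Walk v v), w.IsCycle → 7 ≤ w.length)
    {H : Finset (Sym2 V)} (hHE : H ⊆ E) {L : Sym2 V → Finset ℕ}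
    (hA : Adm K κ H L) {v : V} (hB : ∀ H' ⊂ H, BadBd G K κ d E H') (hd : (nxt H v).card ≤ d) :
    ∑ y ∈ range K, ∑ w ∈ (nxt H v).filter (fun w => y ∈ L s(v, w)), F G H L s(v, w) y ≤
      d / 0.95 * cnt G H L := by
  have h1 : ∀ w ∈ nxt H v, ∑ y ∈ (range K).filter (fun y => y ∈ L s(v, w)), F G H L s(v, w) y ≤
      1 / 0.95 * cnt G H L := by
    intro w hw
    rw [mem_nxt] at hw
    have h2 : ∑ y ∈ (range K).filter (fun y => y ∈ L s(v, w)), 0.95 * F G H L s(v, w) y ≤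
        ∑ y ∈ (range K).filter (fun y => y ∈ L s(v, w)), ecnt G H L s(v, w) y := by
      refine sum_le_sum fun y hy => ?_
      exact A2 hgirth hHE hA hw (hB _ (erase_ssubset hw)) (mem_filter.1 hy).2
    rw [← mul_sum] at h2
    have h3 := h2.trans (sum_ecnt _)
    linarith
  calc _ = ∑ w ∈ nxt H v, ∑ y ∈ (range K).filter (fun y => y ∈ L s(v, w)), F G H L s(v, w) y := by
        simp_rw [sum_filter]
        exact sum_comm
    _ ≤ ∑ w ∈ nxt H v, 1 / 0.95 * cnt G H L := sum_le_sum h1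
    _ = (nxt H v).card * (1 / 0.95 * cnt G H L) := by rw [sum_const, nsmul_eq_mul]
    _ ≤ d * (1 / 0.95 * cnt G H L) := by
        have : (0 : ℝ) ≤ cnt G H L := cnt_nonneg
        gcongr
    _ = _ := by ring

/-- step -/
lemma L3 (hgirth : ∀ (v : V) (w : G.Walk v v), w.IsCycle → 7 ≤ w.length)
    (hκ : 1.326 * (d : ℝ) + 1 ≤ κ) {H : Finset (Sym2 V)} (hHE : H ⊆ E) {L : Sym2 V → Finset ℕ}
    (hA : Adm K κ H L) {v : V} (hB : ∀ H' ⊂ H, BadBd G K κ d E H') (hd : (nxt H v).card ≤ d)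
    (b : ℕ) :
    ∑ w ∈ (nxt H v).filter (fun w => b ∈ L s(v, w)), F G H L s(v, w) b ≤ 5 / 11 * cnt G H L := by
  classical
  set W := (nxt H v).filter (fun w => b ∈ L s(v, w)) with hW
  have hWd : W.card ≤ d := (card_filter_le _ _).trans hd
  have hWm : ∀ w ∈ W, s(v, w) ∈ H ∧ b ∈ L s(v, w) := by
    intro w hw
    rw [hW, mem_filter, mem_nxt] at hw
    exact hw
  set N0 := (cols G H L).filter (fun c => ∀ w ∈ W, c s(v, w) ≠ b) with hN0
  have hS : 0 ≤ ∑ w ∈ W, F G H L s(v, w) b := sum_nonneg fun _ _ => F_nonneg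
  have h1 : 1.25 * ∑ w ∈ W, F G H L s(v, w) b ≤ (N0.card : ℝ) := by
    have h2 : ∀ w ∈ W, 1.25 * d * F G H L s(v, w) b ≤ (N0.card : ℝ) := by
      intro w hw
      refine (A1 hgirth hκ hHE hA (hWm w hw).1 (hB _ (erase_ssubset (hWm w hw).1))
        (hWm w hw).2).trans ?_
      norm_cast
      refine card_le_card ?_
      intro c hc
      rw [mem_filter] at hc
      rw [hN0, mem_filter]
      refine ⟨hc.1, fun w' hw' => ?_⟩
      by_cases he : s(v, w') = s(v, w)
      · rw [he]; exact hc.2.1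
      · exact hc.2.2 _ (hWm w' hw').1 ⟨Ne.symm he, v, by simp, by simp⟩
    have h3 := sum_le_sum h2
    rw [← mul_sum, sum_const, nsmul_eq_mul] at h3
    rcases Nat.eq_zero_or_pos d with h0 | h0
    · have : W = ∅ := by rw [← card_eq_zero]; omega
      rw [this]; simp
    · have h0' : (0 : ℝ) < d := by exact_mod_cast h0
      have h4 : (W.card : ℝ) * N0.card ≤ d * N0.card := by gcongr
      have h5 : (d : ℝ) * (1.25 * ∑ w ∈ W, F G H L s(v, w) b) ≤ d * N0.card := by linarith
      exact le_of_mul_le_mul_left h5 h0'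
  have h2 : 0.95 * ∑ w ∈ W, F G H L s(v, w) b ≤ ∑ w ∈ W, ecnt G H L s(v, w) b := by
    rw [mul_sum]
    exact sum_le_sum fun w hw =>
      A2 hgirth hHE hA (hWm w hw).1 (hB _ (erase_ssubset (hWm w hw).1)) (hWm w hw).2
  have h3 : ∑ w ∈ W, ecnt G H L s(v, w) b + (N0.card : ℝ) ≤ cnt G H L := by
    unfold ecnt cnt
    norm_cast
    rw [← card_biUnion, ← card_union_of_disjoint]
    · refine card_le_card ?_
      intro c hc
      rw [mem_union, mem_biUnion] at hc
      rcases hc with ⟨w, _, hc⟩ | hc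
      · exact (mem_filter.1 hc).1
      · exact (mem_filter.1 hc).1
    · rw [disjoint_left]
      intro c hc hc'
      rw [mem_biUnion] at hc
      obtain ⟨w, hw, hc⟩ := hc
      exact (mem_filter.1 hc').2 w hw (mem_filter.1 hc).2
    · intro w hw w' hw' hne
      rw [Function.onFun, disjoint_left]
      intro c hc hc'
      rw [mem_filter] at hc hc'
      refine (mem_cols.1 hc.1).2.2.1 _ (hWm w hw).1 _ (hWm w' hw').1 ⟨?_, v, by simp, by simp⟩
        (hc.2.trans hc'.2.symm)
      intro he
      rw [Sym2.eq_iff] at he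
      rcases he with h | h
      · exact hne h.2
      · exact hne (h.2.trans h.1)
  linarith

lemma L4 (hgirth : ∀ (v : V) (w : G.Walk v v), w.IsCycle → 7 ≤ w.length)
    (hκ : 1.326 * (d : ℝ) + 1 ≤ κ) {H : Finset (Sym2 V)} (hHE : H ⊆ E) {L : Sym2 V → Finset ℕ}
    (hA : Adm K κ H L) {u v : V} (hg : s(u, v) ∈ H) (hB : BadBd G K κ d E (H.erase s(u, v)))
    (b : ℕ) : (1 + 1.25 * d) * ecnt G H L s(u, v) b ≤ cnt G H L := by
  classical
  by_cases hb : b ∈ L s(u, v)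
  · have h1 := A1 hgirth hκ hHE hA hg hB hb
    have h2 : ecnt G H L s(u, v) b ≤ F G H L s(u, v) b := ecnt_le_F hg
    have h3 : ecnt G H L s(u, v) b + (((cols G H L).filter (fun c => c s(u, v) ≠ b ∧
      ∀ f ∈ H, Adjc s(u, v) f → c f ≠ b)).card : ℝ) ≤ cnt G H L := by
      unfold ecnt cnt
      norm_cast
      rw [← card_union_of_disjoint]
      · refine card_le_card (union_subset (filter_subset _ _) (filter_subset _ _))
      · rw [disjoint_left]
        intro c hc hc'
        exact (mem_filter.1 hc').2.1 (mem_filter.1 hc).2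
    have hd : (0 : ℝ) ≤ d := by positivity
    nlinarith [mul_le_mul_of_nonneg_left h2 hd]
  · have : ecnt G H L s(u, v) b = 0 := by
      unfold ecnt
      rw [Nat.cast_eq_zero, card_eq_zero, filter_eq_empty_iff]
      intro c hc h
      exact hb (h ▸ (mem_cols.1 hc).1 _ hg)
    rw [this, mul_zero]; exact cnt_nonneg

lemma deg_erase (hdeg : ∀ v, (E.filter (fun e => v ∈ e)).card ≤ d + 1) {H : Finset (Sym2 V)}
    (hHE : H ⊆ E) {g : Sym2 V} (hg : g ∈ E) (hgH : g ∉ H) {w : V} (hw : w ∈ g) :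
    (nxt H w).card ≤ d := by
  have h1 : (H.filter (fun e => w ∈ e)) ⊂ E.filter (fun e => w ∈ e) := by
    rw [ssubset_iff_of_subset (filter_subset_filter _ hHE)]
    exact ⟨g, mem_filter.2 ⟨hg, hw⟩, fun h => hgH (mem_filter.1 h).1⟩
  have h2 := card_lt_card h1
  have h3 := card_nxt_le H w
  have h4 := hdeg w
  omega

lemma L5 (hgirth : ∀ (v : V) (w : G.Walk v v), w.IsCycle → 7 ≤ w.length)
    (hκ : 1.326 * (d : ℝ) + 1 ≤ κ) (hdeg : ∀ v, (E.filter (fun e => v ∈ e)).card ≤ d + 1)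
    (t : V) (n : ℕ) : ∀ {H : Finset (Sym2 V)} (_ : H ⊆ E) {L : Sym2 V → Finset ℕ}
    (_ : Adm K κ H L) {v : V} (_ : ∀ H' ⊂ H, BadBd G K κ d E H') (_ : (nxt H v).card ≤ d)
    (b a : ℕ), (1 + 1.25 * d) * tcnt G H L t (n + 1) v b a ≤ (5 / 11) ^ n * cnt G H L := by
  induction n with
  | zero =>
    intro H hHE L hA v hB hd b a
    rw [pow_zero, one_mul]
    by_cases hg : s(v, t) ∈ H
    · refine le_trans ?_ (L4 hgirth hκ hHE hA hg (hB _ (erase_ssubset hg)) b)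
      have := (tcnt_one_le (G := G) (H := H) (L := L) (t := t) (v := v) (b := b) (a := a)).1
      gcongr
    · have := (tcnt_one_le (G := G) (H := H) (L := L) (t := t) (v := v) (b := b) (a := a)).2 hg
      have h2 : (0 : ℝ) ≤ cnt G H L := cnt_nonneg
      rw [zero_add, this, mul_zero]; exact h2
  | succ n ih =>
    intro H hHE L hA v hB hd b a
    have h1 : (1 + 1.25 * d) * tcnt G H L t (n + 1 + 1) v b a ≤
      ∑ w ∈ (nxt H v).filter (fun w => b ∈ L s(v, w)), (5 / 11) ^ n * F G H L s(v, w) b := by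
      refine (mul_le_mul_of_nonneg_left tcnt_succ (by positivity)).trans ?_
      rw [mul_sum]
      refine sum_le_sum fun w hw => ?_
      have hwH := mem_nxt.1 (mem_filter.1 hw).1
      refine ih ((erase_subset _ _).trans hHE) (hA.frz hwH b) ?_ ?_ a b
      · intro H' hH'
        exact hB H' (hH'.trans (erase_ssubset hwH))
      · exact deg_erase hdeg ((erase_subset _ _).trans hHE) (hHE hwH) (notMem_erase _ _) (by simp)
    rw [← mul_sum] at h1
    refine h1.trans ?_
    have h2 := L3 hgirth hκ hHE hA hB hd b
    calc _ ≤ (5 / 11 : ℝ) ^ n * (5 / 11 * cnt G H L) := by gcongr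
      _ = _ := by ring

lemma T1 (hgirth : ∀ (v : V) (w : G.Walk v v), w.IsCycle → 7 ≤ w.length)
    (hκ : 1.326 * (d : ℝ) + 1 ≤ κ) (hdeg : ∀ v, (E.filter (fun e => v ∈ e)).card ≤ d + 1)
    (t : V) (n : ℕ) {H : Finset (Sym2 V)} (hHE : H ⊆ E) {L : Sym2 V → Finset ℕ}
    (hA : Adm K κ H L) {v : V} (hB : ∀ H' ⊂ H, BadBd G K κ d E H') (hd : (nxt H v).card ≤ d)
    (a : ℕ) : (1 + 1.25 * d) * ∑ y ∈ range K, tcnt G H L t (n + 2) v y a ≤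
      (5 / 11) ^ n * (d / 0.95 * cnt G H L) := by
  refine le_trans ?_ (mul_le_mul_of_nonneg_left (sumF hgirth hHE hA hB hd) (by positivity))
  rw [mul_sum, mul_sum]
  refine sum_le_sum fun y _ => ?_
  refine (mul_le_mul_of_nonneg_left tcnt_succ (by positivity)).trans ?_
  rw [mul_sum, mul_sum]
  refine sum_le_sum fun w hw => ?_
  have hwH := mem_nxt.1 (mem_filter.1 hw).1
  refine L5 hgirth hκ hdeg t n ((erase_subset _ _).trans hHE) (hA.frz hwH y) ?_ ?_ a y
  · intro H' hH'
    exact hB H' (hH'.trans (erase_ssubset hwH))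
  · exact deg_erase hdeg ((erase_subset _ _).trans hHE) (hHE hwH) (notMem_erase _ _) (by simp)

lemma T2 (hgirth : ∀ (v : V) (w : G.Walk v v), w.IsCycle → 7 ≤ w.length)
    (hκ : 1.326 * (d : ℝ) + 1 ≤ κ) (hdeg : ∀ v, (E.filter (fun e => v ∈ e)).card ≤ d + 1)
    (t : V) (n : ℕ) {H : Finset (Sym2 V)} (hHE : H ⊆ E) {L : Sym2 V → Finset ℕ}
    (hA : Adm K κ H L) {v : V} (hB : ∀ H' ⊂ H, BadBd G K κ d E H') (hd : (nxt H v).card ≤ d) :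
    (1 + 1.25 * d) * ∑ y ∈ range K, ∑ x ∈ range K, tcnt G H L t (n + 3) v y x ≤
      (5 / 11) ^ n * (d / 0.95) * (d / 0.95 * cnt G H L) := by
  refine le_trans ?_ (mul_le_mul_of_nonneg_left (sumF hgirth hHE hA hB hd) (by positivity))
  rw [mul_sum, mul_sum]
  refine sum_le_sum fun y _ => ?_
  refine (mul_le_mul_of_nonneg_left (sum_le_sum fun x _ => tcnt_succ) (by positivity)).trans ?_
  rw [sum_comm, mul_sum, mul_sum]
  refine sum_le_sum fun w hw => ?_
  have hwH := mem_nxt.1 (mem_filter.1 hw).1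
  have := T1 hgirth hκ hdeg t n ((erase_subset _ _).trans hHE) (hA.frz hwH y) (v := w) ?_ ?_ y
  · refine this.trans (le_of_eq ?_)
    unfold F; ring
  · intro H' hH'
    exact hB H' (hH'.trans (erase_ssubset hwH))
  · exact deg_erase hdeg ((erase_subset _ _).trans hHE) (hHE hwH) (notMem_erase _ _) (by simp)

lemma bads_le {H : Finset (Sym2 V)} {L : Sym2 V → Finset ℕ} {u v : V} {x : ℕ} :
    ((bads G K H L u v x).card : ℝ) ≤
      ∑ n ∈ Ico 7 (H.card + 1), ∑ y ∈ range K, tcnt G H L u n v y x := by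
  classical
  unfold tcnt
  norm_cast
  have : bads G K H L u v x ⊆ (Ico 7 (H.card + 1)).biUnion (fun n => (range K).biUnion (fun y =>
      (cols G H L).filter (fun c => TR c u n H v y x))) := by
    intro c hc
    simp only [bads, mem_filter] at hc
    obtain ⟨hc, y, hy, n, hn, hT⟩ := hc
    rw [mem_biUnion]
    refine ⟨n, hn, ?_⟩
    rw [mem_biUnion]
    exact ⟨y, hy, mem_filter.2 ⟨hc, hT⟩⟩
  refine (card_le_card this).trans (card_biUnion_le.trans (sum_le_sum fun n _ => card_biUnion_le))

lemma geo (j M : ℕ) (hj : j ≤ 7) :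
    ∑ n ∈ Ico 7 M, (5 / 11 : ℝ) ^ (n - j) ≤ (5 / 11) ^ (7 - j) * (11 / 6) := by
  have h1 : ∑ n ∈ Ico 7 M, (5 / 11 : ℝ) ^ (n - j) =
      (5 / 11) ^ (7 - j) * ∑ i ∈ range (M - 7), (5 / 11 : ℝ) ^ i := by
    rw [sum_Ico_eq_sum_range, mul_sum]
    refine sum_congr rfl fun i _ => ?_
    rw [← pow_add]
    congr 1; omega
  rw [h1]
  gcongr
  rw [geom_sum_eq (by norm_num)]
  have : (0 : ℝ) ≤ (5 / 11) ^ (M - 7) := by positivity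
  rw [show (5 / 11 - 1 : ℝ) = -(6 / 11) by norm_num, div_neg, neg_le, le_div_iff₀ (by norm_num)]
  linarith

lemma badBd_step (hgirth : ∀ (v : V) (w : G.Walk v v), w.IsCycle → 7 ≤ w.length)
    (hκ : 1.326 * (d : ℝ) + 1 ≤ κ) (hdeg : ∀ v, (E.filter (fun e => v ∈ e)).card ≤ d + 1)
    {H : Finset (Sym2 V)} (hHE : H ⊆ E) (hB : ∀ H' ⊂ H, BadBd G K κ d E H') :
    BadBd G K κ d E H := by
  intro L hA u v hgE hgH
  have hd : (nxt H v).card ≤ d := deg_erase hdeg hHE hgE hgH (by simp)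
  have hβ : (0 : ℝ) < 1 + 1.25 * d := by positivity
  have hc : (0 : ℝ) ≤ cnt G H L := cnt_nonneg
  have hdd : (0 : ℝ) ≤ d := by positivity
  constructor
  · have h1 : (1 + 1.25 * d) * ∑ x ∈ range K, ((bads G K H L u v x).card : ℝ) ≤
        ∑ n ∈ Ico 7 (H.card + 1), (5 / 11) ^ (n - 3) * ((d / 0.95) * (d / 0.95 * cnt G H L)) := by
      refine (mul_le_mul_of_nonneg_left (sum_le_sum fun x _ => bads_le) hβ.le).trans ?_
      rw [sum_comm, mul_sum]
      refine sum_le_sum fun n hn => ?_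
      have h7 := (mem_Ico.1 hn).1
      have := T2 hgirth hκ hdeg u (n - 3) hHE hA hB hd
      rw [show n - 3 + 3 = n by omega] at this
      rw [sum_comm, ← mul_assoc]
      exact this
    rw [← sum_mul] at h1
    have h2 := h1.trans (mul_le_mul_of_nonneg_right (geo 3 (H.card + 1) (by norm_num))
      (by positivity))
    have h3 : (5 / 11 : ℝ) ^ (7 - 3) * (11 / 6) * ((d / 0.95) * (d / 0.95 * cnt G H L)) ≤
        (1 + 1.25 * d) * (0.076 * d * cnt G H L) := by
      norm_num
      nlinarith [mul_nonneg hdd hc, mul_nonneg hdd (mul_nonneg hdd hc)]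
    exact le_of_mul_le_mul_left (h2.trans h3) hβ
  · intro x
    have h1 : (1 + 1.25 * d) * ((bads G K H L u v x).card : ℝ) ≤
        ∑ n ∈ Ico 7 (H.card + 1), (5 / 11) ^ (n - 2) * (d / 0.95 * cnt G H L) := by
      refine (mul_le_mul_of_nonneg_left bads_le hβ.le).trans ?_
      rw [mul_sum]
      refine sum_le_sum fun n hn => ?_
      have h7 := (mem_Ico.1 hn).1
      have := T1 hgirth hκ hdeg u (n - 2) hHE hA hB hd x
      rwa [show n - 2 + 2 = n by omega] at this
    rw [← sum_mul] at h1
    have h2 := h1.trans (mul_le_mul_of_nonneg_right (geo 2 (H.card + 1) (by norm_num))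
      (by positivity))
    have h3 : (5 / 11 : ℝ) ^ (7 - 2) * (11 / 6) * (d / 0.95 * cnt G H L) ≤
        (1 + 1.25 * d) * (0.05 * cnt G H L) := by
      norm_num
      nlinarith [mul_nonneg hdd hc]
    exact le_of_mul_le_mul_left (h2.trans h3) hβ

lemma badBd_all (hgirth : ∀ (v : V) (w : G.Walk v v), w.IsCycle → 7 ≤ w.length)
    (hκ : 1.326 * (d : ℝ) + 1 ≤ κ) (hdeg : ∀ v, (E.filter (fun e => v ∈ e)).card ≤ d + 1)
    (H : Finset (Sym2 V)) : H ⊆ E → BadBd G K κ d E H := by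
  induction H using Finset.strongInduction with
  | _ H ih =>
    intro hHE
    exact badBd_step hgirth hκ hdeg hHE fun H' hH' => ih H' hH' (hH'.subset.trans hHE)

lemma cnt_pos (hgirth : ∀ (v : V) (w : G.Walk v v), w.IsCycle → 7 ≤ w.length)
    (hκ : 1.326 * (d : ℝ) + 1 ≤ κ) (hdeg : ∀ v, (E.filter (fun e => v ∈ e)).card ≤ d + 1)
    (H : Finset (Sym2 V)) : H ⊆ E → ∀ L, Adm K κ H L → 0 < cnt G H L := by
  classical
  induction H using Finset.strongInduction with
  | _ H ih =>
    intro hHE L hA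
    rcases H.eq_empty_or_nonempty with rfl | ⟨g, hg⟩
    · unfold cnt
      rw [Nat.cast_pos, card_pos]
      refine ⟨fun _ => 0, mem_cols.2 ⟨by simp, by simp, by simp, ?_⟩⟩
      intro v w hw hH
      have := hgirth v w hw
      cases w with
      | nil => simp at this
      | @cons _ y _ h q => exact absurd (hH s(v, y) (by simp)) (by simp)
    · induction g using Sym2.ind with
      | _ u v =>
      have hpos := ih _ (erase_ssubset hg) ((erase_subset _ _).trans hHE) L (hA.erase _)
      have h := ext_count (K := K) hgirth hg (L := L) (L' := L) (X := L s(u, v))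
        (fun f _ => subset_rfl) (fun f hf => (hA f (mem_of_mem_erase hf)).1) subset_rfl κ (by
          intro c _
          have h1 := avail (H := H) (g := s(u, v)) c (L s(u, v))
          have h2 := (hA _ hg).2
          omega)
      have h3 := (badBd_all hgirth hκ hdeg _ ((erase_subset _ _).trans hHE) L (hA.erase s(u, v))
        u v (hHE hg) (notMem_erase _ _)).1
      have h4 : (∑ x ∈ L s(u, v), ((bads G K (H.erase s(u, v)) L u v x).card : ℝ)) ≤
          ∑ x ∈ range K, ((bads G K (H.erase s(u, v)) L u v x).card : ℝ) :=
        sum_le_sum_of_subset_of_nonneg (hA _ hg).1 (fun _ _ _ => by positivity)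
      have h5 : (κ : ℝ) * cnt G (H.erase s(u, v)) L ≤ cnt G H L +
          ∑ x ∈ L s(u, v), ((bads G K (H.erase s(u, v)) L u v x).card : ℝ) := by
        unfold cnt
        exact_mod_cast h.trans (Nat.add_le_add_right (card_filter_le _ _) _)
      have hdd : (0 : ℝ) ≤ d := by positivity
      nlinarith [mul_le_mul_of_nonneg_right hκ hpos.le, mul_nonneg hdd hpos.le]

lemma nb_le (hdeg : ∀ v, (E.filter (fun e => v ∈ e)).card ≤ d + 1) {e : Sym2 V} (he : e ∈ E) :
    nb E e ≤ 2 * d := by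
  classical
  induction e using Sym2.ind with
  | _ u v =>
  unfold nb
  have h : E.filter (Adjc s(u, v)) ⊆ (E.filter (fun e => u ∈ e)).erase s(u, v) ∪
      (E.filter (fun e => v ∈ e)).erase s(u, v) := by
    intro f hf
    rw [mem_filter] at hf
    obtain ⟨hf, hne, w, hw, hwf⟩ := hf
    rw [mem_union, mem_erase, mem_erase, mem_filter, mem_filter]
    rw [Sym2.mem_iff] at hw
    rcases hw with rfl | rfl
    · exact Or.inl ⟨hne.symm, hf, hwf⟩
    · exact Or.inr ⟨hne.symm, hf, hwf⟩
  have h1 := card_le_card h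
  have h2 := card_union_le ((E.filter (fun e => u ∈ e)).erase s(u, v))
      ((E.filter (fun e => v ∈ e)).erase s(u, v))
  rw [card_erase_of_mem (mem_filter.2 ⟨he, by simp⟩),
    card_erase_of_mem (mem_filter.2 ⟨he, by simp⟩)] at h2
  have h3 := hdeg u
  have h4 := hdeg v
  omega

lemma main_aux [DecidableRel G.Adj] (Δ : ℕ) (hdeg : ∀ v, G.degree v ≤ Δ)
    (hgirth : ∀ (v : V) (w : G.Walk v v), w.IsCycle → 7 ≤ w.length) :
    ∃ c : Sym2 V → ℕ,
      (∀ e ∈ G.edgeFinset, c e < ⌈(3.326 : ℝ) * ((Δ : ℝ) - 1)⌉₊ + 1) ∧ Good G G.edgeFinset c := by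
  set K := ⌈(3.326 : ℝ) * ((Δ : ℝ) - 1)⌉₊ + 1 with hK
  set d := Δ - 1 with hd
  have hKd : 3.326 * (d : ℝ) + 1 ≤ K := by
    rw [hK]
    push_cast
    gcongr
    rcases Nat.eq_zero_or_pos Δ with h0 | h0
    · rw [hd, h0]; simp
    · rw [hd, Nat.cast_sub h0, Nat.cast_one]
      exact Nat.le_ceil _
  have h2d : 2 * d ≤ K := by
    have : (2 : ℝ) * d ≤ K := by
      have : (0 : ℝ) ≤ d := by positivity
      linarith
    exact_mod_cast this
  have hκ : 1.326 * (d : ℝ) + 1 ≤ ((K - 2 * d : ℕ) : ℝ) := by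
    rw [Nat.cast_sub h2d]; push_cast; linarith
  have hdeg' : ∀ v, (G.edgeFinset.filter (fun e => v ∈ e)).card ≤ d + 1 := by
    intro v
    have h1 : (G.edgeFinset.filter (fun e => v ∈ e)) = G.incidenceFinset v := by
      ext e
      rw [mem_filter, SimpleGraph.mem_edgeFinset, SimpleGraph.mem_incidenceFinset]
      rfl
    rw [h1, SimpleGraph.card_incidenceFinset_eq_degree]
    have := hdeg v
    omega
  have hA : Adm K (K - 2 * d) G.edgeFinset (fun _ => range K) := by
    intro e he
    refine ⟨subset_rfl, ?_⟩
    have := nb_le hdeg' he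
    rw [card_range]; omega
  have hpos := cnt_pos (K := K) hgirth hκ hdeg' G.edgeFinset subset_rfl _ hA
  unfold cnt at hpos
  rw [Nat.cast_pos, card_pos] at hpos
  obtain ⟨c, hc⟩ := hpos
  have := mem_cols.1 hc
  exact ⟨c, fun e he => mem_range.1 (this.1 e he), this.2.2⟩

end AEC

/-- Every finite simple graph of maximum degree at most `Δ` and girth at
least `7` (every cycle has length at least `7`) admits an acyclic edge
coloring with at most `⌈3.326(Δ-1)⌉ + 1` colors: a proper edge coloring in
which every cycle receives at least three distinct colors on its edges. -/
theorem acyclic_chromatic_index_bound_girth_7 {V : Type*} [Fintype V] [DecidableEq V]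
    (G : SimpleGraph V) [DecidableRel G.Adj] (Δ : ℕ)
    (hdeg : ∀ v, G.degree v ≤ Δ)
    (hgirth : ∀ (v : V) (w : G.Walk v v), w.IsCycle → 7 ≤ w.length) :
    ∃ col : Sym2 V → ℕ,
      (∀ e ∈ G.edgeSet, col e < ⌈(3.326 : ℝ) * ((Δ : ℝ) - 1)⌉₊ + 1) ∧
      IsProperEdgeColoring G col ∧
      ∀ (v : V) (w : G.Walk v v), w.IsCycle →
        3 ≤ (w.edges.map col).toFinset.card := by
  obtain ⟨c, h1, h2, h3⟩ := AEC.main_aux Δ hdeg hgirth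
  refine ⟨c, fun e he => h1 e (SimpleGraph.mem_edgeFinset.2 he), ?_, ?_⟩
  · intro e he f hf hne hv
    exact h2 e (SimpleGraph.mem_edgeFinset.2 he) f (SimpleGraph.mem_edgeFinset.2 hf) ⟨hne, hv⟩
  · intro v w hw
    exact h3 v w hw fun e he => SimpleGraph.mem_edgeFinset.2 (w.edges_subset_edgeSet he)
end

section
/- Every finite simple graph G with maximum degree Δ and girth at least 53 admits an acyclic edge coloring using at most ⌈2.494(Δ-1)⌉ + 1 colors; that is, there is a proper edge coloring of G with ⌈2.494(Δ-1)⌉ + 1 colors under which every cycle of G receives at least three distinct colors on its edges. -/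
namespace AEC

open Finset Classical

set_option linter.unusedSectionVars false

variable {V : Type*} [Fintype V] {K : ℕ}

/-- Proper colorings (of all of `Sym2 V`; non-edges are unconstrained). -/
def Prop' (G : SimpleGraph V) (φ : Sym2 V → Fin K) : Prop :=
  ∀ e₁ ∈ G.edgeSet, ∀ e₂ ∈ G.edgeSet, e₁ ≠ e₂ → (∃ v, v ∈ e₁ ∧ v ∈ e₂) → φ e₁ ≠ φ e₂

/-- Proper colorings agreeing with `ψ` on `P`, with no bichromatic member of `B`. -/
noncomputable def N (G : SimpleGraph V) (P : Finset (Sym2 V)) (ψ : Sym2 V → Fin K)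
    (B : Finset (Finset (Sym2 V))) : Finset (Sym2 V → Fin K) :=
  univ.filter fun φ => Prop' G φ ∧ (∀ e ∈ P, φ e = ψ e) ∧ ∀ C ∈ B, 2 < (C.image φ).card

/-- Members of the family that avoid `g`. -/
noncomputable def rem (B : Finset (Finset (Sym2 V))) (g : Sym2 V) : Finset (Finset (Sym2 V)) :=
  B.filter fun C => g ∉ C

lemma mem_N {G : SimpleGraph V} {P : Finset (Sym2 V)} {ψ : Sym2 V → Fin K}
    {B : Finset (Finset (Sym2 V))} {φ : Sym2 V → Fin K} :
    φ ∈ N G P ψ B ↔ Prop' G φ ∧ (∀ e ∈ P, φ e = ψ e) ∧ ∀ C ∈ B, 2 < (C.image φ).card := by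
  simp [N]

lemma N_mono {G : SimpleGraph V} {P : Finset (Sym2 V)} {ψ : Sym2 V → Fin K}
    {B B' : Finset (Finset (Sym2 V))} (h : B' ⊆ B) : N G P ψ B ⊆ N G P ψ B' := by
  intro φ hφ
  rw [mem_N] at *
  exact ⟨hφ.1, hφ.2.1, fun C hC => hφ.2.2 C (h hC)⟩

lemma N_insert {G : SimpleGraph V} {P : Finset (Sym2 V)} {ψ : Sym2 V → Fin K}
    {B : Finset (Finset (Sym2 V))} {g : Sym2 V} (hg : g ∉ P) (a : Fin K) :
    N G (insert g P) (Function.update ψ g a) B = (N G P ψ B).filter (fun φ => φ g = a) := by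
  ext φ
  rw [mem_filter, mem_N, mem_N]
  have : (∀ e ∈ insert g P, φ e = Function.update ψ g a e) ↔ (∀ e ∈ P, φ e = ψ e) ∧ φ g = a := by
    rw [Finset.forall_mem_insert]
    rw [Function.update_self, and_comm]
    apply and_congr_left'
    refine forall₂_congr fun e he => ?_
    rw [Function.update_of_ne]
    rintro rfl
    exact hg he
  rw [this]
  tauto

lemma sum_pins {G : SimpleGraph V} {P : Finset (Sym2 V)} {ψ : Sym2 V → Fin K}
    {B : Finset (Finset (Sym2 V))} {g : Sym2 V} (hg : g ∉ P) :
    (N G P ψ B).card = ∑ b : Fin K, (N G (insert g P) (Function.update ψ g b) B).card := by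
  rw [Finset.card_eq_sum_card_fiberwise (f := fun φ => φ g) (t := univ) (by simp)]
  refine sum_congr rfl fun b _ => ?_
  rw [N_insert hg]

lemma rem_subset (B : Finset (Finset (Sym2 V))) (g : Sym2 V) : rem B g ⊆ B := filter_subset _ _

lemma mem_rem {B : Finset (Finset (Sym2 V))} {g : Sym2 V} {C} : C ∈ rem B g ↔ C ∈ B ∧ g ∉ C := by
  simp [rem]

/-- Colors available at `g`. -/
noncomputable def avail_s12 (G : SimpleGraph V) (φ : Sym2 V → Fin K) (g : Sym2 V) : Finset (Fin K) :=
  univ.filter fun c => ∀ e ∈ G.edgeSet, e ≠ g → (∃ v, v ∈ e ∧ v ∈ g) → φ e ≠ c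

noncomputable def inc (G : SimpleGraph V) (x : V) : Finset (Sym2 V) :=
  univ.filter fun e => e ∈ G.edgeSet ∧ x ∈ e

lemma mem_inc {G : SimpleGraph V} {x : V} {e} : e ∈ inc G x ↔ e ∈ G.edgeSet ∧ x ∈ e := by
  simp [inc]

lemma inc_card {G : SimpleGraph V} {d : ℕ} (hd : ∀ x, (inc G x).card ≤ d + 1) {x : V} {g : Sym2 V}
    (hg : g ∈ inc G x) : ((inc G x).erase g).card ≤ d := by
  rw [card_erase_of_mem hg]
  have := hd x
  omega

lemma avail_card {G : SimpleGraph V} {d m : ℕ} (hd : ∀ x, (inc G x).card ≤ d + 1)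
    (hK : 2 * d + m ≤ K) (φ : Sym2 V → Fin K) {g : Sym2 V} (hg : g ∈ G.edgeSet) :
    m ≤ (avail_s12 G φ g).card := by
  induction g using Sym2.ind with
  | _ x y =>
    have hx := inc_card hd (mem_inc.2 ⟨hg, Sym2.mem_mk_left x y⟩)
    have hy := inc_card hd (mem_inc.2 ⟨hg, Sym2.mem_mk_right x y⟩)
    have h1 : univ \ (((inc G x).erase s(x, y) ∪ (inc G y).erase s(x, y)).image φ)
        ⊆ avail_s12 G φ s(x, y) := by
      intro c hc
      simp only [mem_sdiff, mem_univ, true_and, mem_image, not_exists, not_and, mem_union,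
        mem_erase, mem_inc] at hc
      simp only [avail_s12, mem_filter, mem_univ, true_and]
      rintro e he hne ⟨v, hv, hv'⟩
      apply hc
      rw [Sym2.mem_iff] at hv'
      rcases hv' with rfl | rfl
      · exact Or.inl ⟨hne, he, hv⟩
      · exact Or.inr ⟨hne, he, hv⟩
    have h2 := card_le_card h1
    have h3 := le_card_sdiff (((inc G x).erase s(x, y) ∪ (inc G y).erase s(x, y)).image φ)
      (univ : Finset (Fin K))
    have h4 : (((inc G x).erase s(x, y) ∪ (inc G y).erase s(x, y)).image φ).card ≤ d + d :=
      card_image_le.trans ((card_union_le _ _).trans (add_le_add hx hy))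
    simp only [card_univ, Fintype.card_fin] at h3
    omega

lemma proper_update {G : SimpleGraph V} {φ : Sym2 V → Fin K} (h : Prop' G φ) {g : Sym2 V}
    {c : Fin K} (hc : c ∈ avail_s12 G φ g) : Prop' G (Function.update φ g c) := by
  simp only [avail_s12, mem_filter, mem_univ, true_and] at hc
  rintro e₁ h₁ e₂ h₂ hne ⟨v, hv1, hv2⟩
  by_cases e1 : e₁ = g
  · subst e1
    rw [Function.update_self, Function.update_of_ne hne.symm]
    exact (hc e₂ h₂ hne.symm ⟨v, hv2, hv1⟩).symm
  · by_cases e2 : e₂ = g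
    · subst e2
      rw [Function.update_self, Function.update_of_ne e1]
      exact hc e₁ h₁ hne ⟨v, hv1, hv2⟩
    · rw [Function.update_of_ne e1, Function.update_of_ne e2]
      exact h e₁ h₁ e₂ h₂ hne ⟨v, hv1, hv2⟩

lemma exists_proper {G : SimpleGraph V} {d m : ℕ} (hd : ∀ x, (inc G x).card ≤ d + 1)
    (hm : 0 < m) (hK : 2 * d + m ≤ K) : ∃ φ : Sym2 V → Fin K, Prop' G φ := by
  have hK0 : 0 < K := by omega
  have key : ∀ S : Finset (Sym2 V), ∃ φ : Sym2 V → Fin K, ∀ e₁ ∈ G.edgeSet, ∀ e₂ ∈ G.edgeSet,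
      e₁ ∈ S → e₂ ∈ S → e₁ ≠ e₂ → (∃ v, v ∈ e₁ ∧ v ∈ e₂) → φ e₁ ≠ φ e₂ := by
    intro S
    induction S using Finset.induction_on with
    | empty => exact ⟨fun _ => ⟨0, hK0⟩, by simp⟩
    | insert g S hgS ih =>
      obtain ⟨φ, hφ⟩ := ih
      by_cases hg : g ∈ G.edgeSet
      · obtain ⟨c, hc⟩ := card_pos.1 (lt_of_lt_of_le hm (avail_card hd hK φ hg))
        simp only [avail_s12, mem_filter, mem_univ, true_and] at hc
        refine ⟨Function.update φ g c, ?_⟩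
        rintro e₁ h₁ e₂ h₂ s1 s2 hne ⟨v, hv1, hv2⟩
        by_cases e1 : e₁ = g
        · subst e1
          rw [Function.update_self, Function.update_of_ne hne.symm]
          exact (hc e₂ h₂ hne.symm ⟨v, hv2, hv1⟩).symm
        · by_cases e2 : e₂ = g
          · subst e2
            rw [Function.update_self, Function.update_of_ne e1]
            exact hc e₁ h₁ hne ⟨v, hv1, hv2⟩
          · rw [Function.update_of_ne e1, Function.update_of_ne e2]
            exact hφ e₁ h₁ e₂ h₂ (mem_of_mem_insert_of_ne s1 e1) (mem_of_mem_insert_of_ne s2 e2)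
              hne ⟨v, hv1, hv2⟩
      · refine ⟨φ, ?_⟩
        intro e₁ h₁ e₂ h₂ s1 s2
        exact hφ e₁ h₁ e₂ h₂ (mem_of_mem_insert_of_ne s1 (by rintro rfl; exact hg h₁))
          (mem_of_mem_insert_of_ne s2 (by rintro rfl; exact hg h₂))
  obtain ⟨φ, hφ⟩ := key univ
  exact ⟨φ, fun e₁ h₁ e₂ h₂ => hφ e₁ h₁ e₂ h₂ (mem_univ _) (mem_univ _)⟩

/-- Recoloring one edge. -/
lemma recolor {G : SimpleGraph V} {d m : ℕ} (hd : ∀ x, (inc G x).card ≤ d + 1)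
    (hK : 2 * d + m ≤ K) {P : Finset (Sym2 V)} {ψ : Sym2 V → Fin K}
    {B : Finset (Finset (Sym2 V))} {g : Sym2 V} (hg : g ∉ P) (hgE : g ∈ G.edgeSet)
    (hB : ∀ C ∈ B, g ∉ C) (a : Fin K) (F : Finset (Sym2 V)) {x : V} (hx : x ∈ g)
    (hF : F ⊆ inc G x) :
    m * (N G (insert g P) (Function.update ψ g a) B).card ≤
      ((N G P ψ B).filter fun φ => ∀ e ∈ F, e ≠ g → φ e ≠ a).card := by
  rw [N_insert hg]
  set X := (N G P ψ B).filter (fun φ => φ g = a) with hX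
  have h1 : m * X.card ≤ (X.sigma fun φ => avail_s12 G φ g).card := by
    rw [card_sigma, mul_comm, ← smul_eq_mul]
    exact card_nsmul_le_sum _ _ _ fun φ _ => avail_card hd hK φ hgE
  refine h1.trans (card_le_card_of_injOn (fun p => Function.update p.1 g p.2) ?_ ?_)
  · rintro ⟨φ, c⟩ hp
    simp only [coe_sigma, Set.mem_sigma_iff, mem_coe, hX, mem_filter, mem_N] at hp
    obtain ⟨⟨⟨hpr, hag, hav⟩, hga⟩, hc⟩ := hp
    simp only [mem_coe, mem_filter, mem_N]
    refine ⟨⟨proper_update hpr hc, ?_, ?_⟩, ?_⟩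
    · intro e he
      rw [Function.update_of_ne (by rintro rfl; exact hg he)]
      exact hag e he
    · intro C hC
      have : C.image (Function.update φ g c) = C.image φ := by
        refine image_congr fun e he => ?_
        rw [Function.update_of_ne]
        rintro rfl
        exact hB C hC he
      rw [this]
      exact hav C hC
    · intro e he hne
      rw [Function.update_of_ne hne, ← hga]
      have := mem_inc.1 (hF he)
      exact hpr e this.1 g hgE hne ⟨x, this.2, hx⟩
  · rintro ⟨φ, c⟩ hp ⟨φ', c'⟩ hp' heq
    simp only [coe_sigma, Set.mem_sigma_iff, mem_coe, hX, mem_filter] at hp hp'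
    have h2 : φ = φ' := by
      funext e
      by_cases he : e = g
      · rw [he, hp.1.2, hp'.1.2]
      · have := congrFun heq e
        simpa [Function.update_of_ne he] using this
    have h3 : c = c' := by simpa using congrFun heq g
    rw [h2, h3]

/-- The inductive claim. -/
def Claim (G : SimpleGraph V) (K : ℕ) (B : Finset (Finset (Sym2 V))) : Prop :=
  ∀ (P : Finset (Sym2 V)) (ψ : Sym2 V → Fin K) (f : Sym2 V), f ∈ P → f ∈ G.edgeSet →
    (∀ C ∈ B, ∀ e ∈ P, e ∈ C → e = f) →
    ((N G P ψ (rem B f)).card : ℝ) ≤ 11 / 10 * (N G P ψ B).card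

lemma claim_cor {G : SimpleGraph V} {B : Finset (Finset (Sym2 V))} (h : Claim G K B)
    (P : Finset (Sym2 V)) (ψ : Sym2 V → Fin K) (f : Sym2 V) (hf : f ∉ P) (hfE : f ∈ G.edgeSet)
    (hB : ∀ C ∈ B, ∀ e ∈ P, e ∉ C) :
    ((N G P ψ (rem B f)).card : ℝ) ≤ 11 / 10 * (N G P ψ B).card := by
  rw [sum_pins hf, sum_pins (B := B) hf]
  push_cast
  rw [mul_sum]
  refine sum_le_sum fun b _ => h _ _ f (mem_insert_self _ _) hfE ?_
  intro C hC e he heC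
  rcases mem_insert.1 he with h' | h'
  · exact h'
  · exact absurd heC (hB C hC e h')

/-- Unpinned edges at `x`. -/
noncomputable def Fr (G : SimpleGraph V) (P : Finset (Sym2 V)) (x : V) : Finset (Sym2 V) :=
  inc G x \ P

lemma Fr_card {G : SimpleGraph V} {d : ℕ} (hd : ∀ x, (inc G x).card ≤ d + 1)
    {P : Finset (Sym2 V)} {x : V} (hP : ∃ p ∈ P, p ∈ inc G x) : (Fr G P x).card ≤ d := by
  obtain ⟨p, hp, hpx⟩ := hP
  refine le_trans (card_le_card ?_) (inc_card hd hpx)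
  intro e he
  simp only [Fr, mem_sdiff] at he
  rw [mem_erase]
  exact ⟨by rintro rfl; exact he.2 hp, he.1⟩

lemma step_arith {α : Type*} (F : Finset α) (X : α → ℝ) (Y : ℝ) (d : ℕ) (hFd : F.card ≤ d)
    (hX0 : ∀ g, 0 ≤ X g) (hY0 : 0 ≤ Y)
    (main : ∀ g ∈ F, (0.494 : ℝ) * d * X g + 10 / 11 * ∑ g ∈ F, X g ≤ 11 / 10 * Y) :
    ∑ g ∈ F, X g ≤ 4 / 5 * Y := by
  have hQ0 : 0 ≤ ∑ g ∈ F, X g := sum_nonneg fun g _ => hX0 g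
  rcases F.eq_empty_or_nonempty with hE | hE
  · rw [hE, sum_empty]
    positivity
  · have hs := sum_le_sum main
    rw [sum_add_distrib, ← mul_sum, sum_const, sum_const, nsmul_eq_mul, nsmul_eq_mul] at hs
    generalize ∑ g ∈ F, X g = Q at *
    have hFd' : (F.card : ℝ) ≤ d := by exact_mod_cast hFd
    have hpos : (0 : ℝ) < F.card := by exact_mod_cast card_pos.2 hE
    have h1 : (0.494 : ℝ) * F.card * Q ≤ 0.494 * d * Q :=
      mul_le_mul_of_nonneg_right (mul_le_mul_of_nonneg_left hFd' (by norm_num)) hQ0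
    have h2 : (F.card : ℝ) * (0.494 * Q + 10 / 11 * Q) ≤ F.card * (11 / 10 * Y) := by
      linarith
    have h3 := le_of_mul_le_mul_left h2 hpos
    norm_num at h3
    linarith

set_option maxHeartbeats 1000000 in
lemma step {G : SimpleGraph V} {d m : ℕ} (hd : ∀ x, (inc G x).card ≤ d + 1)
    (hK : 2 * d + m ≤ K) (hm : (0.494 : ℝ) * d + 1 ≤ m)
    {P : Finset (Sym2 V)} {ψ : Sym2 V → Fin K}
    {B : Finset (Finset (Sym2 V))} (hcl : Claim G K B)
    (hB : ∀ C ∈ B, ∀ e ∈ P, e ∉ C) {x : V} (hP : ∃ p ∈ P, p ∈ inc G x) (a : Fin K) :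
    ∑ g ∈ Fr G P x, ((N G (insert g P) (Function.update ψ g a) (rem B g)).card : ℝ)
      ≤ 4 / 5 * (N G P ψ B).card := by
  set F := Fr G P x with hF
  have hFd : F.card ≤ d := Fr_card hd hP
  set Y : ℝ := ((N G P ψ B).card : ℝ) with hY
  set X : Sym2 V → ℝ := fun g => (N G (insert g P) (Function.update ψ g a) (rem B g)).card with hX
  set Q : ℝ := ∑ g ∈ F, X g with hQ
  have hX0 : ∀ g, 0 ≤ X g := fun g => Nat.cast_nonneg _
  have hQ0 : 0 ≤ Q := sum_nonneg fun g _ => hX0 g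
  have hY0 : 0 ≤ Y := Nat.cast_nonneg _
  have hFm : ∀ g ∈ F, g ∉ P ∧ g ∈ G.edgeSet ∧ x ∈ g := by
    intro g hg
    simp only [hF, Fr, mem_sdiff, mem_inc] at hg
    tauto
  have main : ∀ g ∈ F, (0.494 : ℝ) * d * X g + 10 / 11 * Q ≤ 11 / 10 * Y := by
    intro g hg
    obtain ⟨hgP, hgE, hxg⟩ := hFm g hg
    have h1 : ((N G P ψ (rem B g)).card : ℝ) ≤ 11 / 10 * Y := claim_cor hcl P ψ g hgP hgE hB
    have h2 := recolor hd hK (ψ := ψ) (B := rem B g) hgP hgE (fun C hC => (mem_rem.1 hC).2) a F hxg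
      (by rw [hF]; exact sdiff_subset)
    have h3 : (((N G P ψ (rem B g)).filter fun φ => ∀ e ∈ F, e ≠ g → φ e ≠ a).card)
        + ∑ e ∈ F.erase g, ((N G P ψ (rem B g)).filter fun φ => φ e = a).card
        ≤ (N G P ψ (rem B g)).card := by
      rw [← card_biUnion, ← card_union_of_disjoint]
      · refine card_le_card (union_subset (filter_subset _ _) ?_)
        exact biUnion_subset.2 fun e _ => filter_subset _ _
      · rw [disjoint_left]
        intro φ h h'
        simp only [mem_biUnion, mem_filter, mem_erase] at h h'
        obtain ⟨e, he, _, h''⟩ := h'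
        exact h.2 e he.2 he.1 h''
      · intro e he e' he' hne
        simp only [Function.onFun]
        rw [disjoint_left]
        intro φ h h'
        simp only [mem_filter, mem_N] at h h'
        have m1 := hFm e (mem_of_mem_erase he)
        have m2 := hFm e' (mem_of_mem_erase he')
        exact h.1.1 e m1.2.1 e' m2.2.1 hne ⟨x, m1.2.2, m2.2.2⟩ (h.2.trans h'.2.symm)
    have h4 : ∀ e ∈ F.erase g, 10 / 11 * X e ≤
        (((N G P ψ (rem B g)).filter fun φ => φ e = a).card : ℝ) := by
      intro e he
      obtain ⟨heP, heE, hxe⟩ := hFm e (mem_of_mem_erase he)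
      have h5 := hcl (insert e P) (Function.update ψ e a) e (mem_insert_self _ _) heE (by
        intro C hC e' he' heC
        rcases mem_insert.1 he' with h' | h'
        · exact h'
        · exact absurd heC (hB C hC e' h'))
      have h6 : (N G (insert e P) (Function.update ψ e a) B).card ≤
          ((N G P ψ (rem B g)).filter fun φ => φ e = a).card := by
        rw [N_insert heP]
        exact card_le_card (filter_subset_filter _ (N_mono (rem_subset _ _)))
      have h7 : ((N G (insert e P) (Function.update ψ e a) B).card : ℝ) ≤
          (((N G P ψ (rem B g)).filter fun φ => φ e = a).card : ℝ) := by exact_mod_cast h6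
      have h8 : X e ≤ 11 / 10 * (N G (insert e P) (Function.update ψ e a) B).card := h5
      linarith
    have h5 := sum_le_sum h4
    rw [← mul_sum] at h5
    have h6 : Q = X g + ∑ e ∈ F.erase g, X e := (add_sum_erase F X hg).symm
    have h3' : ((((N G P ψ (rem B g)).filter fun φ => ∀ e ∈ F, e ≠ g → φ e ≠ a).card : ℕ) : ℝ)
        + ∑ e ∈ F.erase g, (((N G P ψ (rem B g)).filter fun φ => φ e = a).card : ℝ)
        ≤ (N G P ψ (rem B g)).card := by exact_mod_cast h3
    have h2' : (m : ℝ) * X g ≤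
      (((N G P ψ (rem B g)).filter fun φ => ∀ e ∈ F, e ≠ g → φ e ≠ a).card : ℝ) := by
      show (m : ℝ) * ((N G (insert g P) (Function.update ψ g a) (rem B g)).card : ℝ) ≤ _
      exact_mod_cast h2
    have h9 : ((0.494 : ℝ) * d + 1) * X g ≤ m * X g := mul_le_mul_of_nonneg_right hm (hX0 g)
    have := hX0 g
    linarith
  exact step_arith F X Y d hFd hX0 hY0 main

/-- Alternating trail of length `k` from `x` to `v` avoiding `P`. -/
def Alt (G : SimpleGraph V) (φ : Sym2 V → Fin K) (v : V) :
    ℕ → Finset (Sym2 V) → V → Fin K → Fin K → Prop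
  | 0, _, x, _, _ => x = v
  | k + 1, P, x, c, c' => ∃ y, G.Adj x y ∧ s(x, y) ∉ P ∧ φ s(x, y) = c ∧
      Alt G φ v k (insert s(x, y) P) y c' c

lemma final_step {G : SimpleGraph V} {d m : ℕ} (hd : ∀ x, (inc G x).card ≤ d + 1)
    (hK : 2 * d + m ≤ K) (hm0 : 0 < m)
    {P : Finset (Sym2 V)} {ψ : Sym2 V → Fin K}
    {B : Finset (Finset (Sym2 V))} (hcl : Claim G K B)
    (hB : ∀ C ∈ B, ∀ e ∈ P, e ∉ C) {g : Sym2 V} (hg : g ∉ P) (hgE : g ∈ G.edgeSet) (a : Fin K) :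
    ((N G (insert g P) (Function.update ψ g a) (rem B g)).card : ℝ)
      ≤ 11 / 10 / m * (N G P ψ B).card := by
  have h1 := claim_cor hcl P ψ g hg hgE hB
  have hm' : (0 : ℝ) < m := by exact_mod_cast hm0
  obtain ⟨x, hx⟩ : ∃ x, x ∈ g := ⟨_, Sym2.out_fst_mem g⟩
  have h2 := (recolor hd hK (ψ := ψ) (B := rem B g) hg hgE (fun C hC => (mem_rem.1 hC).2) a ∅ hx
      (empty_subset _)).trans (card_le_card (filter_subset _ _))
  have h2' : (m : ℝ) * (N G (insert g P) (Function.update ψ g a) (rem B g)).card ≤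
    (N G P ψ (rem B g)).card := by exact_mod_cast h2
  rw [div_mul_eq_mul_div, le_div_iff₀ hm']
  linarith

lemma disj_insert {B : Finset (Finset (Sym2 V))} {P : Finset (Sym2 V)}
    (hB : ∀ C ∈ B, ∀ e ∈ P, e ∉ C) (g : Sym2 V) :
    ∀ C ∈ rem B g, ∀ e ∈ insert g P, e ∉ C := by
  intro C hC e he
  rw [mem_rem] at hC
  rcases mem_insert.1 he with rfl | h
  · exact hC.2
  · exact hB C hC.1 e h

lemma walk_bound {G : SimpleGraph V} {d m : ℕ} (hd : ∀ x, (inc G x).card ≤ d + 1)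
    (hK : 2 * d + m ≤ K) (hm : (0.494 : ℝ) * d + 1 ≤ m) (v : V) (k : ℕ) :
    ∀ (P : Finset (Sym2 V)) (ψ : Sym2 V → Fin K)
    (B : Finset (Finset (Sym2 V))) (_ : ∀ B' ⊆ B, Claim G K B')
    (_ : ∀ C ∈ B, ∀ e ∈ P, e ∉ C) (x : V) (_ : ∃ p ∈ P, p ∈ inc G x) (c c' : Fin K),
    (((N G P ψ B).filter fun φ => Alt G φ v (k + 1) P x c c').card : ℝ)
      ≤ (4 / 5) ^ k * (11 / 10 / m) * (N G P ψ B).card := by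
  have hm0 : 0 < m := by
    have : (0 : ℝ) < m := by
      have : (0 : ℝ) ≤ d := Nat.cast_nonneg _
      linarith
    exact_mod_cast this
  induction k with
  | zero =>
    intro P ψ B hcl hB x hP c c'
    by_cases h : G.Adj x v ∧ s(x, v) ∉ P
    · have h1 := final_step hd hK hm0 (ψ := ψ) (hcl B subset_rfl) hB h.2 (G.mem_edgeSet.2 h.1) c
      rw [pow_zero, one_mul]
      refine le_trans ?_ h1
      rw [N_insert h.2]
      norm_cast
      refine card_le_card ?_
      intro φ hφ
      rw [mem_filter] at hφ ⊢
      obtain ⟨hn, y, _, _, h4, h5⟩ := hφ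
      have h5' : y = v := h5
      subst h5'
      exact ⟨N_mono (rem_subset _ _) hn, h4⟩
    · have : (N G P ψ B).filter (fun φ => Alt G φ v (0 + 1) P x c c') = ∅ := by
        rw [filter_eq_empty_iff]
        rintro φ _ ⟨y, h1, h2, _, h5⟩
        have h5' : y = v := h5
        subst h5'
        exact h ⟨h1, h2⟩
      rw [this, card_empty, Nat.cast_zero]
      positivity
  | succ k ih =>
    intro P ψ B hcl hB x hP c c'
    have hsub : (N G P ψ B).filter (fun φ => Alt G φ v (k + 1 + 1) P x c c') ⊆
        (Fr G P x).biUnion fun g =>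
          (N G (insert g P) (Function.update ψ g c) (rem B g)).filter fun φ =>
            ∃ y, g = s(x, y) ∧ Alt G φ v (k + 1) (insert g P) y c' c := by
      intro φ hφ
      rw [mem_filter] at hφ
      obtain ⟨h1, y, h2, h3, h4, h5⟩ := hφ
      rw [mem_biUnion]
      refine ⟨s(x, y), ?_, ?_⟩
      · simp only [Fr, mem_sdiff, mem_inc]
        exact ⟨⟨G.mem_edgeSet.2 h2, Sym2.mem_mk_left x y⟩, h3⟩
      · rw [mem_filter, N_insert h3, mem_filter]
        exact ⟨⟨N_mono (rem_subset _ _) h1, h4⟩, y, rfl, h5⟩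
    have h1 := (card_le_card hsub).trans card_biUnion_le
    have h1' : (((N G P ψ B).filter fun φ => Alt G φ v (k + 1 + 1) P x c c').card : ℝ) ≤
        ∑ g ∈ Fr G P x, (((N G (insert g P) (Function.update ψ g c) (rem B g)).filter fun φ =>
            ∃ y, g = s(x, y) ∧ Alt G φ v (k + 1) (insert g P) y c' c).card : ℝ) := by
      exact_mod_cast h1
    have h2 := step hd hK hm (ψ := ψ) (hcl B subset_rfl) hB hP c
    have h3 : ∀ g ∈ Fr G P x,
        (((N G (insert g P) (Function.update ψ g c) (rem B g)).filter fun φ =>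
            ∃ y, g = s(x, y) ∧ Alt G φ v (k + 1) (insert g P) y c' c).card : ℝ) ≤
        (4 / 5) ^ k * (11 / 10 / m) * (N G (insert g P) (Function.update ψ g c) (rem B g)).card := by
      intro g hg
      simp only [Fr, mem_sdiff, mem_inc] at hg
      obtain ⟨⟨hgE, hxg⟩, hgP⟩ := hg
      obtain ⟨y, rfl⟩ := Sym2.mem_iff_exists.1 hxg
      refine le_trans ?_ (ih (insert s(x, y) P) (Function.update ψ s(x, y) c) (rem B s(x, y))
        (fun B' h => hcl B' (h.trans (rem_subset _ _))) (disj_insert hB _) y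
        ⟨s(x, y), mem_insert_self _ _, mem_inc.2 ⟨hgE, Sym2.mem_mk_right x y⟩⟩ c' c)
      norm_cast
      refine card_le_card ?_
      intro φ hφ
      rw [mem_filter] at hφ ⊢
      obtain ⟨h1, y', h2, h3⟩ := hφ
      have : y = y' := Sym2.congr_right.1 h2
      subst this
      exact ⟨h1, h3⟩
    refine h1'.trans ((sum_le_sum h3).trans ?_)
    rw [← mul_sum]
    have h4 : (0 : ℝ) ≤ (4 / 5) ^ k * (11 / 10 / m) := by positivity
    calc _ ≤ (4 / 5) ^ k * (11 / 10 / m) * (4 / 5 * ((N G P ψ B).card : ℝ)) :=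
          mul_le_mul_of_nonneg_left h2 h4
      _ = _ := by ring

/-- First step of the walk: the second color is free. -/
lemma start_bound {G : SimpleGraph V} {d m : ℕ} (hd : ∀ x, (inc G x).card ≤ d + 1)
    (hK : 2 * d + m ≤ K) (hm : (0.494 : ℝ) * d + 1 ≤ m) (v : V) (k : ℕ)
    (P : Finset (Sym2 V)) (ψ : Sym2 V → Fin K)
    (B : Finset (Finset (Sym2 V))) (hcl : ∀ B' ⊆ B, Claim G K B')
    (hB : ∀ C ∈ B, ∀ e ∈ P, e ∉ C) (x : V) (hP : ∃ p ∈ P, p ∈ inc G x) (a : Fin K) :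
    (((N G P ψ B).filter fun φ => ∃ b, Alt G φ v (k + 2) P x b a).card : ℝ)
      ≤ (4 / 5) ^ k * (5 / 2) * (N G P ψ B).card := by
  have hd0 : (0 : ℝ) ≤ d := Nat.cast_nonneg _
  have hm0 : (0 : ℝ) < m := by linarith
  have hsub : (N G P ψ B).filter (fun φ => ∃ b, Alt G φ v (k + 2) P x b a) ⊆
      (Fr G P x).biUnion fun g => univ.biUnion fun b : Fin K =>
        (N G (insert g P) (Function.update ψ g b) (rem B g)).filter fun φ =>
          ∃ y, g = s(x, y) ∧ Alt G φ v (k + 1) (insert g P) y a b := by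
    intro φ hφ
    rw [mem_filter] at hφ
    obtain ⟨h1, b, y, h2, h3, h4, h5⟩ := hφ
    rw [mem_biUnion]
    refine ⟨s(x, y), ?_, ?_⟩
    · simp only [Fr, mem_sdiff, mem_inc]
      exact ⟨⟨G.mem_edgeSet.2 h2, Sym2.mem_mk_left x y⟩, h3⟩
    · rw [mem_biUnion]
      refine ⟨b, mem_univ _, ?_⟩
      rw [mem_filter, N_insert h3, mem_filter]
      exact ⟨⟨N_mono (rem_subset _ _) h1, h4⟩, y, rfl, h5⟩
  have h1 := (card_le_card hsub).trans
    (card_biUnion_le.trans (sum_le_sum fun g _ => card_biUnion_le))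
  have h1' : (((N G P ψ B).filter fun φ => ∃ b, Alt G φ v (k + 2) P x b a).card : ℝ) ≤
      ∑ g ∈ Fr G P x, ∑ b : Fin K,
        (((N G (insert g P) (Function.update ψ g b) (rem B g)).filter fun φ =>
          ∃ y, g = s(x, y) ∧ Alt G φ v (k + 1) (insert g P) y a b).card : ℝ) := by
    exact_mod_cast h1
  have h3 : ∀ g ∈ Fr G P x, ∑ b : Fin K,
        (((N G (insert g P) (Function.update ψ g b) (rem B g)).filter fun φ =>
          ∃ y, g = s(x, y) ∧ Alt G φ v (k + 1) (insert g P) y a b).card : ℝ) ≤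
      (4 / 5) ^ k * (11 / 10 / m) * (11 / 10 * (N G P ψ B).card) := by
    intro g hg
    simp only [Fr, mem_sdiff, mem_inc] at hg
    obtain ⟨⟨hgE, hxg⟩, hgP⟩ := hg
    obtain ⟨y, rfl⟩ := Sym2.mem_iff_exists.1 hxg
    have h4 := claim_cor (hcl B subset_rfl) P ψ s(x, y) hgP hgE hB
    have h5 : (0 : ℝ) ≤ (4 / 5) ^ k * (11 / 10 / m) := by positivity
    refine le_trans ?_ (mul_le_mul_of_nonneg_left h4 h5)
    rw [sum_pins hgP]
    push_cast
    rw [mul_sum]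
    refine sum_le_sum fun b _ => ?_
    refine le_trans ?_ (walk_bound hd hK hm v k (insert s(x, y) P) (Function.update ψ s(x, y) b)
      (rem B s(x, y))
      (fun B' h => hcl B' (h.trans (rem_subset _ _))) (disj_insert hB _) y
      ⟨s(x, y), mem_insert_self _ _, mem_inc.2 ⟨hgE, Sym2.mem_mk_right x y⟩⟩ a b)
    norm_cast
    refine card_le_card ?_
    intro φ hφ
    rw [mem_filter] at hφ ⊢
    obtain ⟨h1, y', h2, h3⟩ := hφ
    have : y = y' := Sym2.congr_right.1 h2
    subst this
    exact ⟨h1, h3⟩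
  refine h1'.trans ((sum_le_sum h3).trans ?_)
  rw [sum_const, nsmul_eq_mul]
  have hF : ((Fr G P x).card : ℝ) ≤ d := by exact_mod_cast Fr_card hd hP
  have hY : (0 : ℝ) ≤ (4 / 5) ^ k * ((N G P ψ B).card : ℝ) := by positivity
  have h6 : ((Fr G P x).card : ℝ) * (11 / 10 / m * (11 / 10)) ≤ 5 / 2 := by
    have : ((Fr G P x).card : ℝ) * (11 / 10 / m * (11 / 10)) =
      ((Fr G P x).card : ℝ) * (121 / 100) / m := by ring
    rw [this, div_le_iff₀ hm0]
    norm_num at hm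
    linarith
  calc _ = ((Fr G P x).card : ℝ) * (11 / 10 / m * (11 / 10)) *
        ((4 / 5) ^ k * ((N G P ψ B).card : ℝ)) := by ring
    _ ≤ 5 / 2 * ((4 / 5) ^ k * ((N G P ψ B).card : ℝ)) := mul_le_mul_of_nonneg_right h6 hY
    _ = _ := by ring

lemma alt_of_trail {G : SimpleGraph V} {φ : Sym2 V → Fin K} (hφ : Prop' G φ) {u v : V}
    (r : G.Walk u v) : ∀ (P : Finset (Sym2 V)) (c c' : Fin K) (p : Sym2 V),
    r.edges.Nodup → (∀ e ∈ r.edges, e ∉ P) → (∀ e ∈ r.edges, φ e = c ∨ φ e = c') →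
    p ∈ G.edgeSet → u ∈ p → p ∉ r.edges → φ p = c' → Alt G φ v r.length P u c c' := by
  induction r with
  | nil => intro P c c' p _ _ _ _ _ _ _; rfl
  | @cons u y v h r ih =>
    intro P c c' p hnd hP hc hpE hup hpr hpc
    rw [SimpleGraph.Walk.edges_cons] at hnd hP hc hpr
    rw [List.nodup_cons] at hnd
    have hE : s(u, y) ∈ G.edgeSet := G.mem_edgeSet.2 h
    have hcol : φ s(u, y) = c := by
      rcases hc s(u, y) List.mem_cons_self with h' | h'
      · exact h'
      · exfalso
        refine hφ s(u, y) hE p hpE ?_ ⟨u, Sym2.mem_mk_left u y, hup⟩ (h'.trans hpc.symm)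
        rintro rfl
        exact hpr List.mem_cons_self
    rw [SimpleGraph.Walk.length_cons]
    refine ⟨y, h, hP _ List.mem_cons_self, hcol, ?_⟩
    refine ih _ c' c s(u, y) hnd.2 ?_ ?_ hE (Sym2.mem_mk_right u y) hnd.1 hcol
    · intro e he hin
      rcases mem_insert.1 hin with h' | h'
      · exact hnd.1 (h' ▸ he)
      · exact hP e (List.mem_cons_of_mem _ he) h'
    · intro e he
      exact (hc e (List.mem_cons_of_mem _ he)).symm

/-- Edge set of a cycle. -/
def IsCyc (G : SimpleGraph V) (C : Finset (Sym2 V)) : Prop :=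
  ∃ (x : V) (w : G.Walk x x), w.IsCycle ∧ C = w.edges.toFinset

/-- A walk through an edge splits there. -/
lemma split {G : SimpleGraph V} {x z : V} (w : G.Walk x z) : ∀ f ∈ w.edges,
    ∃ (v u : V) (h : G.Adj v u) (p : G.Walk x v) (q : G.Walk u z), f = s(v, u) ∧
      w = p.append (SimpleGraph.Walk.cons h q) := by
  induction w with
  | nil => intro f hf; simp at hf
  | @cons a b c h r ih =>
    intro f hf
    rw [SimpleGraph.Walk.edges_cons, List.mem_cons] at hf
    rcases hf with hf | hf
    · exact ⟨a, b, h, SimpleGraph.Walk.nil, r, hf, rfl⟩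
    · obtain ⟨v, u, h', p, q, h1, h2⟩ := ih f hf
      exact ⟨v, u, h', SimpleGraph.Walk.cons h p, q, h1, by rw [h2]; rfl⟩

lemma open_cycle {G : SimpleGraph V}
    (hgirth : ∀ (v : V) (w : G.Walk v v), w.IsCycle → 53 ≤ w.length) {C : Finset (Sym2 V)}
    (hC : IsCyc G C) {v u : V} (hf : s(v, u) ∈ C) :
    ∃ (r : G.Walk u v), r.edges.Nodup ∧ s(v, u) ∉ r.edges ∧
      (∀ e ∈ r.edges, e ∈ C) ∧ 52 ≤ r.length := by
  obtain ⟨x, w, hw, rfl⟩ := hC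
  rw [List.mem_toFinset] at hf
  obtain ⟨v', u', h, p, q, hfe, hwe⟩ := split w _ hf
  have hlen := hgirth x w hw
  have hnd := hw.isTrail.edges_nodup
  have hedges : w.edges = p.edges ++ s(v', u') :: q.edges := by
    rw [hwe, SimpleGraph.Walk.edges_append, SimpleGraph.Walk.edges_cons]
  have hperm : (p.edges ++ s(v', u') :: q.edges).Perm (s(v', u') :: (q.edges ++ p.edges)) := by
    refine List.perm_append_comm.trans ?_
    simp
  rw [hedges, hperm.nodup_iff, List.nodup_cons] at hnd
  have key : ∃ (r : G.Walk u' v'), r.edges.Nodup ∧ s(v', u') ∉ r.edges ∧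
      (∀ e ∈ r.edges, e ∈ w.edges.toFinset) ∧ 52 ≤ r.length := by
    refine ⟨q.append p, ?_, ?_, ?_, ?_⟩
    · rw [SimpleGraph.Walk.edges_append]; exact hnd.2
    · rw [SimpleGraph.Walk.edges_append]; exact hnd.1
    · intro e he
      rw [SimpleGraph.Walk.edges_append] at he
      rw [List.mem_toFinset, hedges, hperm.mem_iff]
      exact List.mem_cons_of_mem _ he
    · rw [hwe, SimpleGraph.Walk.length_append, SimpleGraph.Walk.length_cons] at hlen
      rw [SimpleGraph.Walk.length_append]
      omega
  obtain ⟨r, h1, h2, h3, h4⟩ := key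
  rw [Sym2.eq_iff] at hfe
  rcases hfe with ⟨rfl, rfl⟩ | ⟨rfl, rfl⟩
  · exact ⟨r, h1, h2, h3, h4⟩
  · refine ⟨r.reverse, ?_, ?_, ?_, ?_⟩
    · rw [SimpleGraph.Walk.edges_reverse]; exact List.nodup_reverse.2 h1
    · rw [SimpleGraph.Walk.edges_reverse, List.mem_reverse, Sym2.eq_swap]; exact h2
    · intro e he
      rw [SimpleGraph.Walk.edges_reverse, List.mem_reverse] at he
      exact h3 e he
    · rw [SimpleGraph.Walk.length_reverse]; exact h4

lemma claim_all {G : SimpleGraph V} {d m : ℕ} (hd : ∀ x, (inc G x).card ≤ d + 1)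
    (hK : 2 * d + m ≤ K) (hm : (0.494 : ℝ) * d + 1 ≤ m)
    (hgirth : ∀ (v : V) (w : G.Walk v v), w.IsCycle → 53 ≤ w.length) (n : ℕ) :
    ∀ B : Finset (Finset (Sym2 V)), B.card = n → (∀ C ∈ B, IsCyc G C) → Claim G K B := by
  induction n using Nat.strong_induction_on with
  | _ n IH =>
  intro B hBn hcyc P ψ f hfP hfE hB
  by_cases hne : rem B f = B
  · rw [hne]
    have : (0 : ℝ) ≤ (N G P ψ B).card := Nat.cast_nonneg _
    linarith
  have hlt : (rem B f).card < n := by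
    rw [← hBn]
    exact card_lt_card ((rem_subset B f).ssubset_of_ne hne)
  have hcl : ∀ B' ⊆ rem B f, Claim G K B' := fun B' h =>
    IH _ (lt_of_le_of_lt (card_le_card h) hlt) B' rfl
      (fun C hC => hcyc C (rem_subset _ _ (h hC)))
  have hB0 : ∀ C ∈ rem B f, ∀ e ∈ P, e ∉ C := by
    intro C hC e he heC
    rw [mem_rem] at hC
    exact hC.2 (hB C hC.1 e he heC ▸ heC)
  clear hne hlt
  induction f using Sym2.ind with
  | _ v u =>
  set M := Fintype.card (Sym2 V) with hM
  have hsub : N G P ψ (rem B s(v, u)) ⊆ N G P ψ B ∪ (Ico 50 (M + 1)).biUnion fun k =>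
      (N G P ψ (rem B s(v, u))).filter fun φ =>
        ∃ b, Alt G φ v (k + 2) P u b (ψ s(v, u)) := by
    intro φ hφ
    rw [mem_union]
    by_cases hin : φ ∈ N G P ψ B
    · exact Or.inl hin
    right
    have hφ' := mem_N.1 hφ
    rw [mem_N] at hin
    have : ∃ C ∈ B, (C.image φ).card ≤ 2 := by
      by_contra hcon
      push Not at hcon
      exact hin ⟨hφ'.1, hφ'.2.1, hcon⟩
    obtain ⟨C, hC, hC2⟩ := this
    have hfC : s(v, u) ∈ C := by
      by_contra hcon
      have := hφ'.2.2 C (mem_rem.2 ⟨hC, hcon⟩)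
      omega
    obtain ⟨r, r1, r2, r3, r4⟩ := open_cycle hgirth (hcyc C hC) hfC
    have hrM : r.length ≤ M := by
      rw [← SimpleGraph.Walk.length_edges]
      exact r1.length_le_card
    have ha := hφ'.2.1 _ hfP
    have hb : ∃ b, ∀ e ∈ C, φ e = b ∨ φ e = ψ s(v, u) := by
      have h1 : ((C.image φ).erase (ψ s(v, u))).card ≤ 1 := by
        rw [card_erase_of_mem (by rw [← ha]; exact mem_image_of_mem _ hfC)]
        omega
      have : Nonempty (Fin K) := ⟨φ s(v, u)⟩
      obtain ⟨b, hb⟩ := card_le_one_iff_subset_singleton.1 h1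
      refine ⟨b, fun e he => ?_⟩
      by_cases h : φ e = ψ s(v, u)
      · exact Or.inr h
      · left
        exact mem_singleton.1 (hb (mem_erase.2 ⟨h, mem_image_of_mem _ he⟩))
    obtain ⟨b, hb⟩ := hb
    have halt := alt_of_trail hφ'.1 r P b (ψ s(v, u)) s(v, u) r1
      (fun e he heP => r2 (hB C hC e heP (r3 e he) ▸ he))
      (fun e he => hb e (r3 e he)) hfE (Sym2.mem_mk_right v u) r2 ha
    rw [mem_biUnion]
    refine ⟨r.length - 2, ?_, ?_⟩
    · rw [mem_Ico]; omega
    · rw [mem_filter]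
      refine ⟨hφ, b, ?_⟩
      have : r.length - 2 + 2 = r.length := by omega
      rw [this]
      exact halt
  have h1 := (card_le_card hsub).trans ((card_union_le _ _).trans
    (Nat.add_le_add_left card_biUnion_le _))
  have h2 : ((N G P ψ (rem B s(v, u))).card : ℝ) ≤ (N G P ψ B).card + ∑ k ∈ Ico 50 (M + 1),
      (((N G P ψ (rem B s(v, u))).filter fun φ =>
        ∃ b, Alt G φ v (k + 2) P u b (ψ s(v, u))).card : ℝ) := by exact_mod_cast h1
  have h3 : ∑ k ∈ Ico 50 (M + 1), (((N G P ψ (rem B s(v, u))).filter fun φ =>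
        ∃ b, Alt G φ v (k + 2) P u b (ψ s(v, u))).card : ℝ) ≤
      ∑ k ∈ Ico 50 (M + 1), (4 / 5 : ℝ) ^ k * (5 / 2 * (N G P ψ (rem B s(v, u))).card) := by
    refine sum_le_sum fun k _ => ?_
    rw [← mul_assoc]
    exact start_bound hd hK hm v k P ψ _ hcl hB0 u
      ⟨_, hfP, mem_inc.2 ⟨hfE, Sym2.mem_mk_right v u⟩⟩ _
  rw [← sum_mul] at h3
  have h4 : ∑ k ∈ Ico 50 (M + 1), (4 / 5 : ℝ) ^ k ≤ 1 / 1000 := by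
    refine (geom_sum_Ico_le_of_lt_one (by norm_num) (by norm_num)).trans ?_
    norm_num
  have h5 : (0 : ℝ) ≤ (N G P ψ (rem B s(v, u))).card := Nat.cast_nonneg _
  have h6 := mul_le_mul_of_nonneg_right h4
    (show (0 : ℝ) ≤ 5 / 2 * (N G P ψ (rem B s(v, u))).card by positivity)
  linarith

lemma exists_acyclic {G : SimpleGraph V} {d m : ℕ} (hd : ∀ x, (inc G x).card ≤ d + 1)
    (hK : 2 * d + m ≤ K) (hm : (0.494 : ℝ) * d + 1 ≤ m)
    (hgirth : ∀ (v : V) (w : G.Walk v v), w.IsCycle → 53 ≤ w.length) (n : ℕ) :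
    ∀ B : Finset (Finset (Sym2 V)), B.card = n → (∀ C ∈ B, IsCyc G C) →
      ∃ φ : Sym2 V → Fin K, Prop' G φ ∧ ∀ C ∈ B, 2 < (C.image φ).card := by
  induction n using Nat.strong_induction_on with
  | _ n IH =>
  intro B hBn hcyc
  rcases B.eq_empty_or_nonempty with rfl | ⟨C, hC⟩
  · have hm0 : 0 < m := by
      have : (0 : ℝ) < m := by
        have : (0 : ℝ) ≤ d := Nat.cast_nonneg _
        linarith
      exact_mod_cast this
    obtain ⟨φ, hφ⟩ := exists_proper hd hm0 hK
    exact ⟨φ, hφ, by simp⟩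
  · obtain ⟨x, w, hw, hCw⟩ := hcyc C hC
    obtain ⟨f, hf⟩ : ∃ f, f ∈ w.edges := by
      have h := hgirth x w hw
      rw [← SimpleGraph.Walk.length_edges] at h
      exact List.exists_mem_of_length_pos (by omega)
    have hfE := w.edges_subset_edgeSet hf
    have hfC : f ∈ C := by rw [hCw, List.mem_toFinset]; exact hf
    have hlt : (rem B f).card < n := by
      rw [← hBn]
      refine card_lt_card ((rem_subset B f).ssubset_of_ne fun h => ?_)
      rw [← h, mem_rem] at hC
      exact hC.2 hfC
    obtain ⟨φ, h1, h2⟩ := IH _ hlt (rem B f) rfl (fun C hC => hcyc C (rem_subset _ _ hC))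
    have h3 := claim_cor (claim_all hd hK hm hgirth _ B rfl hcyc) ∅ φ f (by simp) hfE (by simp)
    have h4 : 0 < (N G ∅ φ (rem B f)).card := card_pos.2 ⟨φ, mem_N.2 ⟨h1, by simp, h2⟩⟩
    have h5 : (0 : ℝ) < (N G ∅ φ (rem B f)).card := by exact_mod_cast h4
    have h6 : (0 : ℝ) < (N G ∅ φ B).card := by linarith
    have h7 : 0 < (N G ∅ φ B).card := by exact_mod_cast h6
    obtain ⟨φ', h8⟩ := card_pos.1 h7
    rw [mem_N] at h8
    exact ⟨φ', h8.1, h8.2.2⟩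

lemma inc_card_le {G : SimpleGraph V} [DecidableRel G.Adj] {x : V} :
    (inc G x).card ≤ G.degree x := by
  rw [← G.card_incidenceFinset_eq_degree]
  refine card_le_card fun e he => ?_
  rw [mem_inc] at he
  rw [SimpleGraph.mem_incidenceFinset]
  exact he

end AEC

/-- Every finite simple graph of maximum degree at most `Δ` and girth at
least `53` (every cycle has length at least `53`) admits an acyclic edge
coloring with at most `⌈2.494(Δ-1)⌉ + 1` colors: a proper edge coloring in
which every cycle receives at least three distinct colors on its edges. -/
theorem acyclic_chromatic_index_bound_girth_53 {V : Type*} [Fintype V] [DecidableEq V]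
    (G : SimpleGraph V) [DecidableRel G.Adj] (Δ : ℕ)
    (hdeg : ∀ v, G.degree v ≤ Δ)
    (hgirth : ∀ (v : V) (w : G.Walk v v), w.IsCycle → 53 ≤ w.length) :
    ∃ col : Sym2 V → ℕ,
      (∀ e ∈ G.edgeSet, col e < ⌈(2.494 : ℝ) * ((Δ : ℝ) - 1)⌉₊ + 1) ∧
      IsProperEdgeColoring G col ∧
      ∀ (v : V) (w : G.Walk v v), w.IsCycle →
        3 ≤ (w.edges.map col).toFinset.card := by
  classical
  set K := ⌈(2.494 : ℝ) * ((Δ : ℝ) - 1)⌉₊ + 1 with hKdef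
  set d := Δ - 1 with hd
  have hKd : (2.494 : ℝ) * d + 1 ≤ K := by
    rw [hKdef]
    push_cast
    have h1 := Nat.le_ceil ((2.494 : ℝ) * ((Δ : ℝ) - 1))
    rcases Nat.eq_zero_or_pos Δ with h | h
    · have : d = 0 := by omega
      rw [this]
      push_cast
      have := Nat.cast_nonneg (α := ℝ) ⌈(2.494 : ℝ) * ((Δ : ℝ) - 1)⌉₊
      linarith
    · have : (d : ℝ) = (Δ : ℝ) - 1 := by
        rw [hd, Nat.cast_sub h, Nat.cast_one]
      rw [this]
      linarith
  have h2d : 2 * d ≤ K := by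
    have h0 : (0 : ℝ) ≤ d := Nat.cast_nonneg _
    have : ((2 * d : ℕ) : ℝ) ≤ K := by
      push_cast
      norm_num at hKd
      linarith
    exact_mod_cast this
  have hm : (0.494 : ℝ) * d + 1 ≤ ((K - 2 * d : ℕ) : ℝ) := by
    rw [Nat.cast_sub h2d]
    push_cast
    norm_num at hKd ⊢
    linarith
  have hinc : ∀ x, (AEC.inc G x).card ≤ d + 1 := fun x => by
    have h1 := (AEC.inc_card_le (G := G) (x := x)).trans (hdeg x)
    omega
  obtain ⟨φ, h1, h2⟩ := AEC.exists_acyclic (K := K) hinc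
    (show 2 * d + (K - 2 * d) ≤ K by omega) hm hgirth _
    (Finset.univ.filter fun C => AEC.IsCyc G C) rfl (by simp)
  refine ⟨fun e => (φ e : ℕ), fun e _ => (φ e).2, ?_, ?_⟩
  · intro e₁ he₁ e₂ he₂ hne hv heq
    exact h1 e₁ he₁ e₂ he₂ hne hv (Fin.ext heq)
  · intro v w hw
    have hcyc : AEC.IsCyc G w.edges.toFinset := ⟨v, w, hw, by ext; simp⟩
    have h3 := h2 w.edges.toFinset (by simpa using hcyc)
    have h4 : (w.edges.map fun e => (φ e : ℕ)).toFinset =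
        (w.edges.toFinset.image φ).image Fin.val := by
      ext c; simp
    rw [h4, Finset.card_image_of_injective _ Fin.val_injective]
    convert Nat.succ_le_of_lt h3
end
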